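/- arXiv:2105.04825 — 2 statements merged into one kernel-verified Lean document; each statement's English description precedes it below -/
import Mathlib

section
/- Let k ≥ 6. The sequence P(ℝ⁶,𝒱₀) →𝒟₀ P(ℝ⁶,𝒱₁) →𝒟₁ P(ℝ⁶,𝒱₂) →𝒟₂ P(ℝ⁶,𝒱₃) → 0 is exact: for l = 1,2, every 𝒱_l-valued polynomial f on ℝ⁶ with 𝒟_l f = 0 equals 𝒟_{l−1}u for some 𝒱_{l−1}-valued polynomial u, and every 𝒱₃-valued polynomial f equals 𝒟₂u for some 𝒱₂-valued polynomial u. -/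
open scoped BigOperators ComplexConjugate ENNReal
open MeasureTheory

set_option maxHeartbeats 1000000

noncomputable section

/-- The index set `{1,2,3,4}` of spinor indices. -/
abbrev Idx := Fin 4

/-- Tensors with `q` (antisymmetric) superscripts and `p` (symmetric) subscripts,
each index ranging over `{1,2,3,4}`. -/
abbrev Tens (q p : ℕ) := (Fin q → Idx) → (Fin p → Idx) → ℂ

/-- Symmetry in the subscripts. -/
def SymSub {q p : ℕ} (f : Tens q p) : Prop :=
  ∀ (A : Fin q → Idx) (σ : Equiv.Perm (Fin p)) (B : Fin p → Idx), f A (B ∘ σ) = f A B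

/-- Antisymmetry in the superscripts. -/
def AntiSup {q p : ℕ} (f : Tens q p) : Prop :=
  ∀ (σ : Equiv.Perm (Fin q)) (A : Fin q → Idx) (B : Fin p → Idx),
    f (A ∘ σ) B = ((Equiv.Perm.sign σ : ℤ) : ℂ) * f A B

/-- Membership in `V_l = ⊙^p ℂ⁴ ⊗ ∧^q ℂ⁴`: symmetric in subscripts, antisymmetric in
superscripts. -/
def IsMixed {q p : ℕ} (f : Tens q p) : Prop := AntiSup f ∧ SymSub f

/-- Symmetrization `ξ_{(B₁…B_t)}` of a `t`-index tensor. -/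
def symmetrize {t : ℕ} (ξ : (Fin t → Idx) → ℂ) : (Fin t → Idx) → ℂ :=
  fun B => ((t.factorial : ℂ))⁻¹ * ∑ σ : Equiv.Perm (Fin t), ξ (B ∘ σ)

/-- Antisymmetrization `ξ_{[B₁…B_t]}` of a `t`-index tensor. -/
def antisymmetrize {t : ℕ} (ξ : (Fin t → Idx) → ℂ) : (Fin t → Idx) → ℂ :=
  fun B => ((t.factorial : ℂ))⁻¹ * ∑ σ : Equiv.Perm (Fin t),
    ((Equiv.Perm.sign σ : ℤ) : ℂ) * ξ (B ∘ σ)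

/-- The contraction `𝒞(f)^{A₁…A_{q}}_{B₁…B_{p}} = Σ_C f^{C A₁…A_q}_{B₁…B_p C}`. -/
def contr {q p : ℕ} (f : Tens (q+1) (p+1)) : Tens q p :=
  fun A B => ∑ C : Idx, f (Fin.cons C A) (Fin.snoc B C)

/-- The Hermitian inner product on tensors, induced from `⊗^k ℂ⁴`. -/
def tinner {q p : ℕ} (f h : Tens q p) : ℂ :=
  ∑ A : Fin q → Idx, ∑ B : Fin p → Idx, f A B * conj (h A B)

/-- The squared norm of a tensor. -/
def tnormSq {q p : ℕ} (f : Tens q p) : ℝ :=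
  ∑ A : Fin q → Idx, ∑ B : Fin p → Idx, Complex.normSq (f A B)
/-- Points of `ℝ⁶`, with coordinates `x 0, …, x 5`. -/
abbrev Pt := Fin 6 → ℝ

/-- Coefficients (in front of `∂_{x_j}`) of the operators `∇^{AB}`:
`∇^{12}=i∂₀+∂₅`, `∇^{13}=∂₃+i∂₄`, `∇^{14}=∂₁+i∂₂`, `∇^{23}=∂₁−i∂₂`,
`∇^{24}=−∂₃+i∂₄`, `∇^{34}=−i∂₀+∂₅`, antisymmetric. -/
def nablaCoeff : Fin 4 → Fin 4 → Fin 6 → ℂ :=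
  ![![(0 : Fin 6 → ℂ), ![Complex.I,0,0,0,0,1], ![0,0,0,1,Complex.I,0], ![0,1,Complex.I,0,0,0]],
    ![-![Complex.I,0,0,0,0,1], (0 : Fin 6 → ℂ), ![0,1,-Complex.I,0,0,0], ![0,0,0,-1,Complex.I,0]],
    ![-![0,0,0,1,Complex.I,0], -![0,1,-Complex.I,0,0,0], (0 : Fin 6 → ℂ), ![-Complex.I,0,0,0,0,1]],
    ![-![0,1,Complex.I,0,0,0], -![0,0,0,-1,Complex.I,0], -![-Complex.I,0,0,0,0,1], (0 : Fin 6 → ℂ)]]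

/-- The partial derivative `∂_{x_j} u (x)` of a complex valued function on `ℝ⁶`. -/
def pd (j : Fin 6) (u : Pt → ℂ) (x : Pt) : ℂ := fderiv ℝ u x (Pi.single j 1)

/-- The first order constant coefficient differential operator `∇^{AB}`. -/
def nabla (A B : Fin 4) (u : Pt → ℂ) (x : Pt) : ℂ :=
  ∑ j : Fin 6, nablaCoeff A B j * pd j u x

/-- `ε_{ABCD}`: the sign of the permutation `(1,2,3,4) ↦ (A,B,C,D)`, `0` if indices repeat. -/
def eps (A B C D : Fin 4) : ℤ :=
  if h : Function.Bijective ![A,B,C,D] then (Equiv.Perm.sign (Equiv.ofBijective _ h) : ℤ) else 0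

/-- The lowered operator `∇_{AB} := (1/2) Σ_{C,D} ε_{ABCD} ∇^{CD}`. -/
def nablaLow (A B : Fin 4) (u : Pt → ℂ) (x : Pt) : ℂ :=
  (2 : ℂ)⁻¹ * ∑ C : Fin 4, ∑ D : Fin 4, ((eps A B C D : ℤ) : ℂ) * nabla C D u x

/-- The weight `φ(x) = |x|²`. -/
def phi (x : Pt) : ℝ := ∑ j : Fin 6, (x j)^2

/-- `Θ_{AB} u := −e^{φ} ∇_{AB}(e^{−φ} u)`, the formal adjoint of `∇^{AB}` in `L²_φ`. -/
def Theta (A B : Fin 4) (u : Pt → ℂ) (x : Pt) : ℂ :=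
  - (Real.exp (phi x) : ℂ) * nablaLow A B (fun y => (Real.exp (-(phi y)) : ℂ) * u y) x

/-- The operator `𝒟_l`:
`(𝒟_l f)^{A₁…A_{l+1}}_{B₂…B_{k−l}} = Σ_{B₁} ∇^{B₁[A₁} f^{A₂…A_{l+1}]}_{B₁B₂…B_{k−l}}`,
where `[⋯]` antisymmetrizes the superscripts. -/
def Dop {q p : ℕ} (u : Pt → Tens q (p+1)) (x : Pt) : Tens (q+1) p :=
  fun A B => antisymmetrize
    (fun A' => ∑ B₁ : Idx, nabla B₁ (A' 0) (fun y => u y (Fin.tail A') (Fin.cons B₁ B)) x) A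

/-- The formal adjoint `𝒟_l^⋆`:
`(𝒟_l^⋆ f)^{A₁…A_l}_{B₁…B_{k−l}} = −Σ_E Θ_{E(B₁} f^{EA₁…A_l}_{B₂…B_{k−l})}`,
where `(⋯)` symmetrizes the subscripts. -/
def DopStar {q p : ℕ} (u : Pt → Tens (q+1) p) (x : Pt) : Tens q (p+1) :=
  fun A B => - symmetrize
    (fun B' => ∑ E : Idx, Theta E (B' 0) (fun y => u y (Fin.cons E A) (Fin.tail B')) x) B

/-- A tensor-valued function is smooth iff all its components are. -/
def TensSmooth {q p : ℕ} (u : Pt → Tens q p) : Prop :=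
  ∀ A B, ContDiff ℝ (⊤ : ℕ∞) fun x => u x A B

/-- A tensor-valued function is compactly supported iff all its components are. -/
def TensCpt {q p : ℕ} (u : Pt → Tens q p) : Prop :=
  ∀ A B, HasCompactSupport fun x => u x A B
/-- A tensor-valued map on `ℝ⁶` is polynomial iff each component is a polynomial function. -/
def IsPolyMap {q p : ℕ} (f : Pt → Tens q p) : Prop :=
  ∀ A B, ∃ P : MvPolynomial (Fin 6) ℂ,
    ∀ x : Pt, f x A B = MvPolynomial.eval (fun j => ((x j : ℝ) : ℂ)) P

/-- Membership in `𝒱₀` (no contraction condition). -/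
def InV0 {p : ℕ} (t : Tens 0 p) : Prop := IsMixed t

/-- Membership in `𝒱_l`, `l ≥ 1`: mixed symmetry and vanishing contraction. -/
def InV {q p : ℕ} (t : Tens (q+1) (p+1)) : Prop :=
  IsMixed t ∧ ∀ A B, contr t A B = 0

section Alternating

variable {M : Type*} [AddCommGroup M] [Module ℂ M] {q : ℕ}

/-- Alternating families indexed by `q`-tuples. -/
def IsAlt (f : (Fin q → Fin 4) → M) : Prop :=
  ∀ (σ : Equiv.Perm (Fin q)) (A : Fin q → Fin 4), f (A ∘ σ) = ((Equiv.Perm.sign σ : ℤ) : ℂ) • f A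

/-- The exterior product of a family with the operator-valued covector `X`. -/
def wedge (X : Fin 4 → M →ₗ[ℂ] M) (f : (Fin q → Fin 4) → M) : (Fin (q + 1) → Fin 4) → M :=
  fun A => ∑ i : Fin (q + 1), (-1 : ℂ) ^ (i : ℕ) • X (A i) (f (Fin.removeNth i A))

/-- The contraction of a family with the operator-valued vector `Y`. -/
def inter (Y : Fin 4 → M →ₗ[ℂ] M) (f : (Fin (q + 1) → Fin 4) → M) : (Fin q → Fin 4) → M :=
  fun A => ∑ C : Fin 4, Y C (f (Fin.cons C A))

theorem removeNth_succ_cons (i : Fin (q + 1)) (C : Fin 4) (A : Fin (q + 1) → Fin 4) :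
    Fin.removeNth i.succ (Fin.cons C A : Fin (q + 2) → Fin 4) = Fin.cons C (Fin.removeNth i A) := by
  funext j
  refine Fin.cases ?_ (fun j => ?_) j <;> simp [Fin.removeNth]

theorem wedge_cons (X : Fin 4 → M →ₗ[ℂ] M) (f : (Fin (q + 1) → Fin 4) → M) (C : Fin 4)
    (A : Fin (q + 1) → Fin 4) :
    wedge X f (Fin.cons C A) = X C (f A) - wedge X (fun A' => f (Fin.cons C A')) A := by
  simp only [wedge]
  rw [Fin.sum_univ_succ]
  simp only [removeNth_succ_cons, Fin.cons_succ, Fin.val_succ, pow_succ, mul_neg, mul_one,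
    neg_smul, Finset.sum_neg_distrib, Fin.cons_zero, Fin.val_zero, pow_zero, one_smul,
    sub_eq_add_neg]
  congr 3

theorem inter_wedge_add_wedge_inter (X Y : Fin 4 → M →ₗ[ℂ] M) (f : (Fin (q + 1) → Fin 4) → M)
    (A : Fin (q + 1) → Fin 4) :
    inter Y (wedge X f) A + wedge X (inter Y f) A = ∑ C, Y C (X C (f A)) +
      ∑ i : Fin (q + 1), (-1 : ℂ) ^ (i : ℕ) • ∑ C,
        (X (A i) (Y C (f (Fin.cons C (Fin.removeNth i A)))) -
          Y C (X (A i) (f (Fin.cons C (Fin.removeNth i A))))) := by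
  have hw : wedge X (inter Y f) A = ∑ i : Fin (q + 1), ∑ C, (-1 : ℂ) ^ (i : ℕ) •
      X (A i) (Y C (f (Fin.cons C (Fin.removeNth i A)))) := by
    simp [wedge, inter, Finset.smul_sum]
  rw [hw]
  simp only [inter, wedge_cons, map_sub, Finset.sum_sub_distrib, smul_sub]
  have : ∀ C, Y C (wedge X (fun A' => f (Fin.cons C A')) A) = ∑ i : Fin (q + 1),
      (-1 : ℂ) ^ (i : ℕ) • Y C (X (A i) (f (Fin.cons C (Fin.removeNth i A)))) := by
    intro C
    simp [wedge, map_sum]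
  simp only [this]
  rw [Finset.sum_comm]
  simp only [Finset.smul_sum]
  abel

theorem wedge_wedge (X : Fin 4 → M →ₗ[ℂ] M) (hX : ∀ a b g, X a (X b g) = X b (X a g)) :
    ∀ {q : ℕ} (f : (Fin q → Fin 4) → M), wedge X (wedge X f) = 0 := by
  intro q
  induction q with
  | zero =>
    intro f
    funext A
    have : ∀ B : Fin 0 → Fin 4, B = Fin.elim0 := fun B => Subsingleton.elim _ _
    simp [wedge, Fin.sum_univ_two, hX (A 0) (A 1), Fin.removeNth, this]
  | succ q ih =>
    intro f
    funext A
    obtain ⟨C, A, rfl⟩ : ∃ C A', A = Fin.cons C A' := ⟨A 0, Fin.tail A, (Fin.cons_self_tail A).symm⟩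
    rw [wedge_cons]
    have h1 : (fun A' => wedge X f (Fin.cons C A')) =
        fun A' => X C (f A') - wedge X (fun A' => f (Fin.cons C A')) A' := by
      funext A'
      rw [wedge_cons]
    have h2 : wedge X (fun A' => X C (f A') - wedge X (fun A' => f (Fin.cons C A')) A') A =
        X C (wedge X f A) - wedge X (wedge X (fun A' => f (Fin.cons C A'))) A := by
      simp only [wedge, map_sub, smul_sub, Finset.sum_sub_distrib, map_sum, map_smul, hX C]
    rw [h1, h2, ih]
    simp

theorem IsAlt.cons {f : (Fin (q + 1) → Fin 4) → M} (hf : IsAlt f) (C : Fin 4) :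
    IsAlt fun A => f (Fin.cons C A) := by
  intro σ A
  have h := hf (Equiv.Perm.decomposeFin.symm (0, σ)) (Fin.cons C A)
  rw [Equiv.Perm.decomposeFin.symm_sign, if_pos rfl, one_mul] at h
  rw [← h]
  change f (Fin.cons C (A ∘ σ)) = _
  congr 1
  funext j
  refine Fin.cases ?_ (fun j => ?_) j
  · simp
  · simp

theorem isAlt_of_cons {f : (Fin (q + 2) → Fin 4) → M} (hc : ∀ C, IsAlt fun A => f (Fin.cons C A))
    (hs : ∀ a b A, f (Fin.cons a (Fin.cons b A)) = -f (Fin.cons b (Fin.cons a A))) : IsAlt f := by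
  intro σ
  have hσ : σ ∈ Submonoid.closure
      (Set.range fun i : Fin (q + 1) => Equiv.swap i.castSucc i.succ) := by
    rw [Equiv.Perm.mclosure_swap_castSucc_succ]
    trivial
  induction hσ using Submonoid.closure_induction with
  | one => intro A; simp
  | mul σ τ _ _ h1 h2 =>
    intro A
    rw [Equiv.Perm.coe_mul, ← Function.comp_assoc, h2, h1, smul_smul, Equiv.Perm.sign_mul, mul_comm]
    push_cast
    rfl
  | mem σ hσ =>
    obtain ⟨i, rfl⟩ := hσ
    intro A
    dsimp only
    rw [Equiv.Perm.sign_swap (Fin.castSucc_lt_succ).ne]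
    refine Fin.cases ?_ (fun j => ?_) i
    · have h := hs (A 0) (A 1) (Fin.tail (Fin.tail A))
      have h1 : (Fin.cons (A 0) (Fin.cons (A 1) (Fin.tail (Fin.tail A)) : Fin (q + 1) → Fin 4) :
          Fin (q + 2) → Fin 4) = A := by
        funext j
        refine Fin.cases rfl (fun j => Fin.cases rfl (fun j => rfl) j) j
      have h2 : (Fin.cons (A 1) (Fin.cons (A 0) (Fin.tail (Fin.tail A)) : Fin (q + 1) → Fin 4) :
          Fin (q + 2) → Fin 4) = A ∘ Equiv.swap (Fin.castSucc 0) (Fin.succ 0) := by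
        funext j
        refine Fin.cases (by simp) (fun j => Fin.cases (by simp) (fun j => ?_) j) j
        rw [Function.comp_apply, Equiv.swap_apply_of_ne_of_ne (by simp)
          (by simp [Fin.ext_iff])]
        rfl
      rw [h1, h2] at h
      rw [h]
      simp
    · have h := hc (A 0) (Equiv.swap j.castSucc j.succ) (Fin.tail A)
      dsimp only at h
      rw [Equiv.Perm.sign_swap (Fin.castSucc_lt_succ).ne, Fin.cons_self_tail] at h
      rw [← h]
      congr 1
      funext l
      refine Fin.cases ?_ (fun l => ?_) l
      · rw [Function.comp_apply, Equiv.swap_apply_of_ne_of_ne]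
        · rfl
        · simp [Fin.ext_iff]
        · simp [Fin.ext_iff]
      · simp only [Function.comp_apply, Fin.cons_succ, Fin.tail, Fin.castSucc_succ]
        rw [Function.Injective.map_swap (Fin.succ_injective _)]

theorem isAlt_of_subsingleton [Subsingleton (Fin q)] (f : (Fin q → Fin 4) → M) : IsAlt f := by
  intro σ A
  rw [Subsingleton.elim σ 1]
  simp

theorem IsAlt.cons_cons {f : (Fin (q + 2) → Fin 4) → M} (hf : IsAlt f) (a b : Fin 4)
    (A : Fin q → Fin 4) :
    f (Fin.cons a (Fin.cons b A)) = -f (Fin.cons b (Fin.cons a A)) := by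
  have h := hf (Equiv.swap 0 1) (Fin.cons b (Fin.cons a A))
  rw [Equiv.Perm.sign_swap (by simp)] at h
  simp only [Units.val_neg, Units.val_one, Int.cast_neg, Int.cast_one, neg_smul, one_smul] at h
  rw [← h]
  congr 1
  funext j
  refine Fin.cases (by simp) (fun j => Fin.cases (by simp) (fun j => ?_) j) j
  rw [Function.comp_apply, Equiv.swap_apply_of_ne_of_ne (by simp) (by simp [Fin.ext_iff])]
  rfl

theorem IsAlt.sub {f g : (Fin q → Fin 4) → M} (hf : IsAlt f) (hg : IsAlt g) :
    IsAlt fun A => f A - g A := by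
  intro σ A
  simp only [hf σ A, hg σ A, smul_sub]

theorem IsAlt.map {f : (Fin q → Fin 4) → M} (hf : IsAlt f) (Y : M →ₗ[ℂ] M) :
    IsAlt fun A => Y (f A) := by
  intro σ A
  simp only [hf σ A, map_smul]

theorem IsAlt.inter {f : (Fin (q + 1) → Fin 4) → M} (hf : IsAlt f) (Y : Fin 4 → M →ₗ[ℂ] M) :
    IsAlt (inter Y f) := by
  intro σ A
  simp only [_root_.inter, (hf.cons _) σ A, map_smul, Finset.smul_sum]

theorem isAlt_wedge (X : Fin 4 → M →ₗ[ℂ] M) :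
    ∀ {q : ℕ} {f : (Fin q → Fin 4) → M}, IsAlt f → IsAlt (wedge X f) := by
  intro q
  induction q with
  | zero => intro f _; exact isAlt_of_subsingleton (q := 1) _
  | succ q ih =>
    intro f hf
    refine isAlt_of_cons (fun C => ?_) (fun a b A => ?_)
    · simp only [wedge_cons]
      exact (hf.map _).sub (ih (hf.cons C))
    · cases q with
      | zero =>
        have : ∀ B : Fin 0 → Fin 4, B = Fin.elim0 := fun B => Subsingleton.elim _ _
        rw [wedge_cons, wedge_cons]
        simp [wedge, this]
      | succ q =>
        simp only [wedge_cons]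
        simp only [wedge, hf.cons_cons a b, map_neg, smul_neg, Finset.sum_neg_distrib]
        abel

theorem IsAlt.eq_zero {f : (Fin q → Fin 4) → M} (hf : IsAlt f) {A : Fin q → Fin 4}
    (hA : ¬ Function.Injective A) : f A = 0 := by
  simp only [Function.Injective, not_forall] at hA
  obtain ⟨i, j, hij, hne⟩ := hA
  have h := hf (Equiv.swap i j) A
  have hA : A ∘ Equiv.swap i j = A := by
    funext l
    rw [Function.comp_apply, Equiv.swap_apply_def]
    split_ifs with h1 h2
    · rw [h1, hij]
    · rw [h2, hij]
    · rfl
  rw [hA, Equiv.Perm.sign_swap hne] at h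
  simp only [Units.val_neg, Units.val_one, Int.cast_neg, Int.cast_one, neg_smul, one_smul] at h
  have h2 : (2 : ℂ) • f A = 0 := by
    rw [two_smul]
    nth_rewrite 1 [h]
    simp
  exact (smul_eq_zero.mp h2).resolve_left two_ne_zero

theorem IsAlt.cons_removeNth {f : (Fin (q + 1) → Fin 4) → M} (hf : IsAlt f)
    (A : Fin (q + 1) → Fin 4) (i : Fin (q + 1)) :
    (-1 : ℂ) ^ (i : ℕ) • f (Fin.cons (A i) (Fin.removeNth i A)) = f A := by
  rw [Fin.cons_removeNth_eq_comp_cycleRange_symm, hf, ← Equiv.Perm.inv_def, Equiv.Perm.sign_inv,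
    Fin.sign_cycleRange, smul_smul]
  push_cast
  rw [← mul_pow]
  simp

theorem inter_inter (Y : Fin 4 → M →ₗ[ℂ] M) (hY : ∀ a b g, Y a (Y b g) = Y b (Y a g))
    {f : (Fin (q + 2) → Fin 4) → M} (hf : IsAlt f) : inter Y (inter Y f) = 0 := by
  funext A
  have h : inter Y (inter Y f) A = -inter Y (inter Y f) A := by
    conv_lhs => simp only [inter, map_sum]
    rw [Finset.sum_comm]
    simp only [inter, map_sum, ← Finset.sum_neg_distrib]
    refine Finset.sum_congr rfl fun a _ => Finset.sum_congr rfl fun b _ => ?_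
    rw [hf.cons_cons, map_neg, map_neg, hY]
  have h2 : (2 : ℂ) • inter Y (inter Y f) A = 0 := by
    rw [two_smul]
    nth_rewrite 1 [h]
    simp
  exact (smul_eq_zero.mp h2).resolve_left two_ne_zero

/-- Antisymmetrizing `X ⊗ f` over all superscripts gives a multiple of `wedge X f`. -/
theorem sum_perm_eq_wedge (X : Fin 4 → M →ₗ[ℂ] M) {f : (Fin q → Fin 4) → M} (hf : IsAlt f)
    (A : Fin (q + 1) → Fin 4) :
    ∑ σ : Equiv.Perm (Fin (q + 1)), ((Equiv.Perm.sign σ : ℤ) : ℂ) •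
      X (A (σ 0)) (f (Fin.tail (A ∘ σ))) = (q.factorial : ℂ) • wedge X f A := by
  have hterm : ∀ σ : Equiv.Perm (Fin (q + 1)), ((Equiv.Perm.sign σ : ℤ) : ℂ) •
      X (A (σ 0)) (f (Fin.tail (A ∘ σ))) =
      (-1 : ℂ) ^ (σ 0 : ℕ) • X (A (σ 0)) (f (Fin.removeNth (σ 0) A)) := by
    intro σ
    obtain ⟨⟨a, τ⟩, hτ⟩ := Equiv.Perm.decomposeFin.symm.surjective ((σ 0).cycleRange * σ)
    have ha : a = 0 := by
      have := congrArg (fun ρ : Equiv.Perm (Fin (q + 1)) => ρ 0) hτ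
      simpa using this
    subst ha
    have hsucc : ∀ x, σ x.succ = (σ 0).succAbove (τ x) := by
      intro x
      have := congrArg (fun ρ : Equiv.Perm (Fin (q + 1)) => ρ x.succ) hτ
      simp only [Equiv.Perm.decomposeFin_symm_apply_succ, Equiv.swap_self, Equiv.refl_apply,
        Equiv.Perm.mul_apply] at this
      rw [← Fin.cycleRange_symm_succ, this, Equiv.symm_apply_apply]
    have hsign : Equiv.Perm.sign τ = (-1) ^ (σ 0 : ℕ) * Equiv.Perm.sign σ := by
      have := congrArg Equiv.Perm.sign hτ
      simpa [Equiv.Perm.decomposeFin.symm_sign] using this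
    have htail : Fin.tail (A ∘ σ) = Fin.removeNth (σ 0) A ∘ τ := by
      funext x
      simp [Fin.tail, Fin.removeNth, hsucc]
    rw [htail, hf τ, hsign, map_smul, smul_smul]
    congr 1
    rcases Int.units_eq_one_or (Equiv.Perm.sign σ) with h | h <;> simp [h]
  rw [Finset.sum_congr rfl fun σ _ => hterm σ, ← Equiv.sum_comp Equiv.Perm.decomposeFin.symm,
    Fintype.sum_prod_type]
  simp only [Equiv.Perm.decomposeFin_symm_apply_zero, Finset.sum_const, Finset.card_univ,
    Fintype.card_perm, Fintype.card_fin, wedge, Finset.smul_sum, Nat.cast_smul_eq_nsmul]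

end Alternating

section Perturbation

variable {M : Type*} [AddCommGroup M] [Module ℂ M] {q : ℕ}

/-- A filtration and approximate right inverses `J j`, `j ≠ 3`, of three of the four commuting
operators `P a`. The operator `P a` raises the filtration degree by `r a`, and up to higher
filtration degree `J j` is a right inverse of `P j` that commutes with the other operators. -/
structure KoszulData (P J : Fin 4 → M →ₗ[ℂ] M) (r : Fin 4 → ℤ) (F : ℤ → Submodule ℂ M) : Prop where
  comm : ∀ a b g, P a (P b g) = P b (P a g)
  nonneg : ∀ a, 0 ≤ r a
  anti : Antitone F
  one : F 1 = ⊥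
  mapP : ∀ a n g, g ∈ F n → P a g ∈ F (n + r a)
  mapJ : ∀ j n g, j ≠ 3 → g ∈ F n → J j g ∈ F (n - r j)
  mapComm : ∀ a j n g, j ≠ 3 → a ≠ j → g ∈ F n →
    P a (J j g) - J j (P a g) ∈ F (n + r a - r j + 1)
  mapInv : ∀ j n g, j ≠ 3 → g ∈ F n → g - P j (J j g) ∈ F (n + 1)

/-- The chain map homotopic to the identity through contraction with `J j`. -/
def homotoped (P J : Fin 4 → M →ₗ[ℂ] M) (j : Fin 4) (f : (Fin (q + 1) → Fin 4) → M) :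
    (Fin (q + 1) → Fin 4) → M :=
  fun A => f A - (inter (Pi.single j (J j)) (wedge P f) A +
    wedge P (inter (Pi.single j (J j)) f) A)

theorem sum_pi_single_apply (J : M →ₗ[ℂ] M) (j : Fin 4) (g : Fin 4 → M) :
    ∑ C, (Pi.single j J : Fin 4 → M →ₗ[ℂ] M) C (g C) = J (g j) := by
  rw [Finset.sum_eq_single j]
  · simp
  · intro b _ hb
    simp [Pi.single_eq_of_ne hb]
  · simp

theorem homotoped_apply (P J : Fin 4 → M →ₗ[ℂ] M) (j : Fin 4) (f : (Fin (q + 1) → Fin 4) → M)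
    (A : Fin (q + 1) → Fin 4) :
    homotoped P J j f A = f A - J j (P j (f A)) - ∑ i : Fin (q + 1), (-1 : ℂ) ^ (i : ℕ) •
      (P (A i) (J j (f (Fin.cons j (Fin.removeNth i A)))) -
        J j (P (A i) (f (Fin.cons j (Fin.removeNth i A))))) := by
  have h := sum_pi_single_apply (J j) j fun C => P C (f A)
  have h' : ∀ i : Fin (q + 1), ∑ C, (P (A i) ((Pi.single j (J j) : Fin 4 → M →ₗ[ℂ] M) C
        (f (Fin.cons C (Fin.removeNth i A)))) -
      (Pi.single j (J j) : Fin 4 → M →ₗ[ℂ] M) C (P (A i) (f (Fin.cons C (Fin.removeNth i A))))) =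
      P (A i) (J j (f (Fin.cons j (Fin.removeNth i A)))) -
        J j (P (A i) (f (Fin.cons j (Fin.removeNth i A)))) := by
    intro i
    rw [Finset.sum_sub_distrib, ← map_sum, sum_pi_single_apply (J j) j fun C =>
      f (Fin.cons C (Fin.removeNth i A)), sum_pi_single_apply (J j) j fun C =>
      P (A i) (f (Fin.cons C (Fin.removeNth i A)))]
  rw [homotoped, inter_wedge_add_wedge_inter, h, Finset.sum_congr rfl fun i _ => by rw [h' i]]
  abel

variable {P J : Fin 4 → M →ₗ[ℂ] M} {r : Fin 4 → ℤ} {F : ℤ → Submodule ℂ M}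

theorem isAlt_homotoped {f : (Fin (q + 1) → Fin 4) → M} (hf : IsAlt f) (j : Fin 4) :
    IsAlt (homotoped P J j f) := by
  have h1 := (isAlt_wedge P hf).inter (Pi.single j (J j))
  have h2 := isAlt_wedge P (hf.inter (Pi.single j (J j)))
  intro σ A
  simp only [homotoped, hf σ A, h1 σ A, h2 σ A, smul_sub, smul_add]

theorem homotoped_term_mem (hK : KoszulData P J r F) {j : Fin 4} (hj : j ≠ 3) {w : ℤ}
    {f : (Fin (q + 1) → Fin 4) → M} (hF : ∀ A, f A ∈ F (w + ∑ i, r (A i)))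
    (A : Fin (q + 1) → Fin 4) (i : Fin (q + 1)) (hi : A i ≠ j) :
    P (A i) (J j (f (Fin.cons j (Fin.removeNth i A)))) -
      J j (P (A i) (f (Fin.cons j (Fin.removeNth i A)))) ∈ F (w + 1 + ∑ i, r (A i)) := by
  have h := hK.mapComm (A i) j _ _ hj hi (hF (Fin.cons j (Fin.removeNth i A)))
  rw [Fin.sum_univ_succ] at h
  rw [Fin.sum_univ_succAbove _ i]
  convert h using 2
  simp only [Fin.cons_zero, Fin.cons_succ, Fin.removeNth]
  ring

theorem homotoped_sub_mem (hK : KoszulData P J r F) {j : Fin 4} (hj : j ≠ 3) {w : ℤ}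
    {f : (Fin (q + 1) → Fin 4) → M} (hF : ∀ A, f A ∈ F (w + ∑ i, r (A i)))
    {A : Fin (q + 1) → Fin 4} (hA : ∀ i, A i ≠ j) :
    homotoped P J j f A - (f A - J j (P j (f A))) ∈ F (w + 1 + ∑ i, r (A i)) := by
  rw [homotoped_apply, sub_sub_cancel_left]
  exact neg_mem (sum_mem fun i _ => Submodule.smul_mem _ _ (homotoped_term_mem hK hj hF A i (hA i)))

theorem homotoped_mem_of_mem_range (hK : KoszulData P J r F) {j : Fin 4} (hj : j ≠ 3) {w : ℤ}
    {f : (Fin (q + 1) → Fin 4) → M} (hf : IsAlt f) (hF : ∀ A, f A ∈ F (w + ∑ i, r (A i)))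
    {A : Fin (q + 1) → Fin 4} (hA : Function.Injective A) {l : Fin (q + 1)} (hl : A l = j) :
    homotoped P J j f A ∈ F (w + 1 + ∑ i, r (A i)) := by
  have hterm : (-1 : ℂ) ^ (l : ℕ) • (P (A l) (J j (f (Fin.cons j (Fin.removeNth l A)))) -
      J j (P (A l) (f (Fin.cons j (Fin.removeNth l A))))) =
      P j (J j (f A)) - J j (P j (f A)) := by
    have h := hf.cons_removeNth A l
    rw [hl] at h
    rw [hl, ← h]
    simp [smul_sub]
  rw [homotoped_apply, Fin.sum_univ_succAbove (fun i : Fin (q + 1) => (-1 : ℂ) ^ (i : ℕ) •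
    (P (A i) (J j (f (Fin.cons j (Fin.removeNth i A)))) -
      J j (P (A i) (f (Fin.cons j (Fin.removeNth i A)))))) l, hterm]
  have h1 := hK.mapInv j _ _ hj (hF A)
  have h2 : ∑ i : Fin q, (-1 : ℂ) ^ (l.succAbove i : ℕ) •
      (P (A (l.succAbove i)) (J j (f (Fin.cons j (Fin.removeNth (l.succAbove i) A)))) -
        J j (P (A (l.succAbove i)) (f (Fin.cons j (Fin.removeNth (l.succAbove i) A))))) ∈
      F (w + 1 + ∑ i, r (A i)) :=
    sum_mem fun i _ => Submodule.smul_mem _ _ (homotoped_term_mem hK hj hF A _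
      (fun h => Fin.succAbove_ne l i (hA (h.trans hl.symm))))
  rw [add_right_comm] at h1
  convert sub_mem h1 h2 using 1
  abel

theorem mapJP (hK : KoszulData P J r F) {j : Fin 4} (hj : j ≠ 3) {n : ℤ} {g : M} (hg : g ∈ F n) :
    g - J j (P j g) ∈ F n := by
  have := hK.mapJ j _ _ hj (hK.mapP j n g hg)
  rw [add_sub_cancel_right] at this
  exact sub_mem hg this

theorem homotoped_mem_succ (hK : KoszulData P J r F) {j : Fin 4} (hj : j ≠ 3) {w : ℤ}
    {f : (Fin (q + 1) → Fin 4) → M} (hf : IsAlt f) (hF : ∀ A, f A ∈ F (w + ∑ i, r (A i)))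
    {A : Fin (q + 1) → Fin 4} (hA : f A ∈ F (w + 1 + ∑ i, r (A i)) ∨ ∃ l, A l = j) :
    homotoped P J j f A ∈ F (w + 1 + ∑ i, r (A i)) := by
  by_cases hinj : Function.Injective A
  · by_cases hl : ∃ l, A l = j
    · obtain ⟨l, hl⟩ := hl
      exact homotoped_mem_of_mem_range hK hj hf hF hinj hl
    · have h := hA.resolve_right hl
      push Not at hl
      simpa using add_mem (homotoped_sub_mem hK hj hF hl) (mapJP hK hj h)
  · rw [(isAlt_homotoped hf j).eq_zero hinj]
    exact zero_mem _

theorem homotoped_mem (hK : KoszulData P J r F) {j : Fin 4} (hj : j ≠ 3) {w : ℤ}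
    {f : (Fin (q + 1) → Fin 4) → M} (hf : IsAlt f) (hF : ∀ A, f A ∈ F (w + ∑ i, r (A i)))
    (A : Fin (q + 1) → Fin 4) : homotoped P J j f A ∈ F (w + ∑ i, r (A i)) := by
  have hle : F (w + 1 + ∑ i, r (A i)) ≤ F (w + ∑ i, r (A i)) := hK.anti (by linarith)
  by_cases hl : ∃ l, A l = j
  · exact hle (homotoped_mem_succ hK hj hf hF (.inr hl))
  · push Not at hl
    simpa using add_mem (hle (homotoped_sub_mem hK hj hF hl)) (mapJP hK hj (hF A))

theorem wedge_homotoped (hK : KoszulData P J r F) (j : Fin 4) {f : (Fin (q + 1) → Fin 4) → M}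
    (h0 : wedge P f = 0) :
    wedge P (homotoped P J j f) = 0 ∧
      f = wedge P (inter (Pi.single j (J j)) f) + homotoped P J j f := by
  have h1 : inter (Pi.single j (J j)) (wedge P f) = 0 := by
    rw [h0]
    funext A
    simp [inter]
  have h2 : homotoped P J j f = f - wedge P (inter (Pi.single j (J j)) f) := by
    funext A
    simp [homotoped, h1]
  have h3 : wedge P (f - wedge P (inter (Pi.single j (J j)) f)) =
      wedge P f - wedge P (wedge P (inter (Pi.single j (J j)) f)) := by
    funext A
    simp [wedge, smul_sub, Finset.sum_sub_distrib]
  constructor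
  · rw [h2, h3, h0, wedge_wedge P hK.comm, sub_zero]
  · rw [h2, add_sub_cancel]

theorem wedge_add (X : Fin 4 → M →ₗ[ℂ] M) (f g : (Fin q → Fin 4) → M) :
    wedge X (f + g) = wedge X f + wedge X g := by
  funext A
  simp [wedge, smul_add, Finset.sum_add_distrib]

theorem IsAlt.add {f g : (Fin q → Fin 4) → M} (hf : IsAlt f) (hg : IsAlt g) : IsAlt (f + g) := by
  intro σ A
  simp only [Pi.add_apply, hf σ A, hg σ A, smul_add]

/-- Bounded families. -/
def IsBdd (F : ℤ → Submodule ℂ M) (f : (Fin q → Fin 4) → M) : Prop := ∃ n, ∀ A, f A ∈ F n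

theorem IsBdd.add (hF : Antitone F) {f g : (Fin q → Fin 4) → M} (hf : IsBdd F f) (hg : IsBdd F g) :
    IsBdd F (f + g) := by
  obtain ⟨n, hn⟩ := hf
  obtain ⟨n', hn'⟩ := hg
  exact ⟨min n n', fun A => add_mem (hF (min_le_left _ _) (hn A)) (hF (min_le_right _ _) (hn' A))⟩

theorem isBdd_of_weighted (hK : KoszulData P J r F) {w : ℤ}
    {f : (Fin q → Fin 4) → M} (hF : ∀ A, f A ∈ F (w + ∑ i, r (A i))) : IsBdd F f :=
  ⟨w, fun A => hK.anti (le_add_of_nonneg_right (Finset.sum_nonneg fun i _ => hK.nonneg (A i)))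
    (hF A)⟩

theorem isBdd_inter_single (hK : KoszulData P J r F) {j : Fin 4} (hj : j ≠ 3)
    {f : (Fin (q + 1) → Fin 4) → M} (hf : IsBdd F f) :
    IsBdd F (inter (Pi.single j (J j)) f) := by
  obtain ⟨n, hn⟩ := hf
  refine ⟨n - r j, fun A => ?_⟩
  rw [inter, sum_pi_single_apply (J j) j fun C => f (Fin.cons C A)]
  exact hK.mapJ j _ _ hj (hn _)

/-- The Koszul complex of `P` is exact at families with at least two superscripts. -/
theorem exists_wedge_eq (hK : KoszulData P J r F) {f : (Fin (q + 2) → Fin 4) → M} (hf : IsAlt f)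
    (hb : IsBdd F f) (h0 : wedge P f = 0) :
    ∃ u : (Fin (q + 1) → Fin 4) → M, IsAlt u ∧ IsBdd F u ∧ wedge P u = f := by
  obtain ⟨R, hR⟩ : ∃ R, ∀ A : Fin (q + 2) → Fin 4, ∑ i, r (A i) ≤ R :=
    (Set.finite_range fun A : Fin (q + 2) → Fin 4 => ∑ i, r (A i)).bddAbove.imp
      fun R hR A => hR ⟨A, rfl⟩
  obtain ⟨n, hn⟩ := hb
  have hw : ∃ w, ∀ A, f A ∈ F (w + ∑ i, r (A i)) :=
    ⟨n - R, fun A => hK.anti (by linarith [hR A]) (hn A)⟩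
  obtain ⟨w, hw⟩ := hw
  clear hn n hR R
  obtain ⟨N, hN⟩ : ∃ N : ℕ, 1 ≤ w + N := ⟨(1 - w).toNat, by linarith [Int.self_le_toNat (1 - w)]⟩
  induction N generalizing f w with
  | zero =>
    have hf0 : f = 0 := by
      funext A
      have h := hK.anti (a := 1) (by
        have := Finset.sum_nonneg fun i (_ : i ∈ Finset.univ) => hK.nonneg (A i)
        push_cast at hN
        linarith) (hw A)
      rw [hK.one] at h
      simpa using h
    refine ⟨0, fun σ A => by simp, ⟨0, fun A => zero_mem _⟩, ?_⟩
    rw [hf0]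
    funext A
    simp [wedge]
  | succ N ih =>
    have e0 : (0 : Fin 4) ≠ 3 := by decide
    have e1 : (1 : Fin 4) ≠ 3 := by decide
    have e2 : (2 : Fin 4) ≠ 3 := by decide
    obtain ⟨c0, d0⟩ := wedge_homotoped hK 0 h0
    obtain ⟨c1, d1⟩ := wedge_homotoped hK 1 c0
    obtain ⟨c2, d2⟩ := wedge_homotoped hK 2 c1
    have a0 := isAlt_homotoped (P := P) (J := J) hf 0
    have a1 := isAlt_homotoped (P := P) (J := J) a0 1
    have a2 := isAlt_homotoped (P := P) (J := J) a1 2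
    have w0 := homotoped_mem hK e0 hf hw
    have w1 := homotoped_mem hK e1 a0 w0
    have hmem : ∀ A, homotoped P J 2 (homotoped P J 1 (homotoped P J 0 f)) A ∈
        F (w + 1 + ∑ i, r (A i)) := by
      intro A
      by_cases hA : Function.Injective A
      · have : ∃ j l, j ≠ 3 ∧ A l = j := by
          by_contra! h
          have h3 : ∀ l, A l = 3 := fun l => by
            by_contra hl
            exact h _ l hl rfl
          exact absurd (hA ((h3 0).trans (h3 1).symm)) (by simp)
        obtain ⟨j, l, hj, hl⟩ := this
        refine homotoped_mem_succ hK e2 a1 w1 ?_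
        by_cases j2 : j = 2
        · exact .inr ⟨l, by rw [hl, j2]⟩
        refine .inl (homotoped_mem_succ hK e1 a0 w0 ?_)
        by_cases j1 : j = 1
        · exact .inr ⟨l, by rw [hl, j1]⟩
        refine .inl (homotoped_mem_succ hK e0 hf hw (.inr ⟨l, ?_⟩))
        rw [hl]
        clear hl
        revert j
        decide
      · rw [a2.eq_zero hA]
        exact zero_mem _
    obtain ⟨u, ua, ub, hu⟩ := ih a2 c2 (w + 1) hmem (by push_cast at hN; linarith)
    refine ⟨inter (Pi.single 0 (J 0)) f + (inter (Pi.single 1 (J 1)) (homotoped P J 0 f) +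
      (inter (Pi.single 2 (J 2)) (homotoped P J 1 (homotoped P J 0 f)) + u)), ?_, ?_, ?_⟩
    · exact (hf.inter _).add ((a0.inter _).add ((a1.inter _).add ua))
    · exact (isBdd_inter_single hK e0 (isBdd_of_weighted hK hw)).add hK.anti
        ((isBdd_inter_single hK e1 (isBdd_of_weighted hK w0)).add hK.anti
        ((isBdd_inter_single hK e2 (isBdd_of_weighted hK w1)).add hK.anti ub))
    · rw [wedge_add, wedge_add, wedge_add, hu, ← d2, ← d1, ← d0]

end Perturbation

section Series

/-- Formal series in six variables `y` and four variables `z`, given by their coefficients with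
respect to the monomials `y ^ m z ^ n / (m! n!)`. -/
abbrev Ser := (Fin 6 ⊕ Fin 4 → ℕ) → ℂ

/-- The partial derivative in the variable `i`. -/
def shift (i : Fin 6 ⊕ Fin 4) : Ser →ₗ[ℂ] Ser where
  toFun g m := g (m + Pi.single i 1)
  map_add' _ _ := rfl
  map_smul' _ _ := rfl

/-- The antiderivative in the variable `i`. -/
def raise (i : Fin 6 ⊕ Fin 4) : Ser →ₗ[ℂ] Ser where
  toFun g m := if m i = 0 then 0 else g (m - Pi.single i 1)
  map_add' _ _ := by
    funext m
    by_cases h : m i = 0 <;> simp [h]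
  map_smul' _ _ := by
    funext m
    by_cases h : m i = 0 <;> simp [h]

/-- Multiplication by the variable `i`. -/
def mulVar (i : Fin 6 ⊕ Fin 4) : Ser →ₗ[ℂ] Ser where
  toFun g m := (m i : ℂ) * g (m - Pi.single i 1)
  map_add' _ _ := by
    funext m
    simp [mul_add]
  map_smul' _ _ := by
    funext m
    simp [mul_left_comm]

theorem shift_comm (i j : Fin 6 ⊕ Fin 4) (g : Ser) : shift i (shift j g) = shift j (shift i g) := by
  funext m
  simp only [shift, LinearMap.coe_mk, AddHom.coe_mk]
  rw [add_right_comm]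

theorem sub_single_add_single {i : Fin 6 ⊕ Fin 4} {m : Fin 6 ⊕ Fin 4 → ℕ} (h : m i ≠ 0) :
    m - Pi.single i 1 + Pi.single i 1 = m := by
  funext l
  by_cases hl : l = i
  · subst hl
    simp only [Pi.add_apply, Pi.sub_apply, Pi.single_eq_same]
    omega
  · simp [Pi.single_eq_of_ne hl]

theorem add_single_sub_single_comm {i j : Fin 6 ⊕ Fin 4} (hij : i ≠ j) (m : Fin 6 ⊕ Fin 4 → ℕ) :
    m + Pi.single i 1 - Pi.single j 1 = m - Pi.single j 1 + Pi.single i 1 := by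
  funext l
  by_cases hl : l = j
  · subst hl
    simp [Pi.single_eq_of_ne hij.symm]
  · simp [Pi.single_eq_of_ne hl]

theorem shift_raise_self (i : Fin 6 ⊕ Fin 4) (g : Ser) : shift i (raise i g) = g := by
  funext m
  simp [shift, raise]

theorem shift_raise {i j : Fin 6 ⊕ Fin 4} (hij : i ≠ j) (g : Ser) :
    shift i (raise j g) = raise j (shift i g) := by
  funext m
  simp [shift, raise, add_single_sub_single_comm hij, Pi.single_eq_of_ne hij.symm]

theorem shift_mulVar {i j : Fin 6 ⊕ Fin 4} (hij : i ≠ j) (g : Ser) :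
    shift i (mulVar j g) = mulVar j (shift i g) := by
  funext m
  simp [shift, mulVar, add_single_sub_single_comm hij, Pi.single_eq_of_ne hij.symm]

theorem shift_mulVar_self (i : Fin 6 ⊕ Fin 4) (g : Ser) (m : Fin 6 ⊕ Fin 4 → ℕ) :
    shift i (mulVar i g) m = (m i + 1) * g m := by
  simp [shift, mulVar]

theorem mulVar_shift_self (i : Fin 6 ⊕ Fin 4) (g : Ser) (m : Fin 6 ⊕ Fin 4 → ℕ) :
    mulVar i (shift i g) m = m i * g m := by
  by_cases h : m i = 0
  · simp [mulVar, h]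
  · simp [shift, mulVar, sub_single_add_single h]

/-- The weight of an exponent. -/
def weight (c : Fin 6 ⊕ Fin 4 → ℤ) (m : Fin 6 ⊕ Fin 4 → ℕ) : ℤ := ∑ i, c i * m i

theorem weight_add_single (c : Fin 6 ⊕ Fin 4 → ℤ) (m : Fin 6 ⊕ Fin 4 → ℕ) (i : Fin 6 ⊕ Fin 4) :
    weight c (m + Pi.single i 1) = weight c m + c i := by
  simp only [weight, Pi.add_apply, Nat.cast_add, mul_add, Finset.sum_add_distrib]
  congr 1
  rw [Finset.sum_eq_single i]
  · simp
  · intro b _ hb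
    simp [Pi.single_eq_of_ne hb]
  · simp

/-- Series all of whose exponents have weight at least `n`. -/
def weightGE (c : Fin 6 ⊕ Fin 4 → ℤ) (n : ℤ) : Submodule ℂ Ser where
  carrier := {g | ∀ m, weight c m < n → g m = 0}
  add_mem' ha hb m hm := by simp [ha m hm, hb m hm]
  zero_mem' _ _ := rfl
  smul_mem' a g hg m hm := by simp [hg m hm]

theorem weightGE_anti (c : Fin 6 ⊕ Fin 4 → ℤ) : Antitone (weightGE c) :=
  fun _ _ h _ hg m hm => hg m (lt_of_lt_of_le hm h)

theorem shift_mem {c : Fin 6 ⊕ Fin 4 → ℤ} {n : ℤ} (i : Fin 6 ⊕ Fin 4) {g : Ser}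
    (hg : g ∈ weightGE c n) : shift i g ∈ weightGE c (n - c i) := by
  intro m hm
  exact hg _ (by rw [weight_add_single]; linarith)

theorem raise_mem {c : Fin 6 ⊕ Fin 4 → ℤ} {n : ℤ} (i : Fin 6 ⊕ Fin 4) {g : Ser}
    (hg : g ∈ weightGE c n) : raise i g ∈ weightGE c (n + c i) := by
  intro m hm
  by_cases h : m i = 0
  · simp [raise, h]
  · simp only [raise, LinearMap.coe_mk, AddHom.coe_mk, h, if_false]
    refine hg _ ?_
    rw [← sub_single_add_single h, weight_add_single] at hm
    linarith

theorem mulVar_mem {c : Fin 6 ⊕ Fin 4 → ℤ} {n : ℤ} (i : Fin 6 ⊕ Fin 4) {g : Ser}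
    (hg : g ∈ weightGE c n) : mulVar i g ∈ weightGE c (n + c i) := by
  intro m hm
  by_cases h : m i = 0
  · simp [mulVar, h]
  · simp only [mulVar, LinearMap.coe_mk, AddHom.coe_mk]
    rw [hg _ ?_, mul_zero]
    rw [← sub_single_add_single h, weight_add_single] at hm
    linarith

/-- The operator `∇^{BA}` in the coordinates `y^{12}, y^{13}, y^{14}, y^{23}, y^{24}, y^{34}`. -/
def nablaSer : Fin 4 → Fin 4 → Ser →ₗ[ℂ] Ser :=
  ![![0, shift (.inl 0), shift (.inl 1), shift (.inl 2)],
    ![-shift (.inl 0), 0, shift (.inl 3), shift (.inl 4)],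
    ![-shift (.inl 1), -shift (.inl 3), 0, shift (.inl 5)],
    ![-shift (.inl 2), -shift (.inl 4), -shift (.inl 5), 0]]

/-- The operator `P^A = Σ_B ∇^{BA} ∂_{z^B}`. -/
def opP (A : Fin 4) : Ser →ₗ[ℂ] Ser := ∑ B, nablaSer B A ∘ₗ shift (.inr B)

/-- The part of `opP` of lowest filtration degree. -/
def leadP : Fin 4 → Ser →ₗ[ℂ] Ser :=
  ![-(shift (.inl 0) ∘ₗ shift (.inr 1)), -(shift (.inl 4) ∘ₗ shift (.inr 3)),
    shift (.inl 1) ∘ₗ shift (.inr 0), 0]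

/-- Right inverses of `leadP`. -/
def antiP : Fin 4 → Ser →ₗ[ℂ] Ser :=
  ![-(raise (.inl 0) ∘ₗ raise (.inr 1)), -(raise (.inl 4) ∘ₗ raise (.inr 3)),
    raise (.inl 1) ∘ₗ raise (.inr 0), 0]

/-- The weights defining the filtration. -/
def wtY : Fin 6 ⊕ Fin 4 → ℤ := Sum.elim ![-2, -3, -4, -4, -1, -4] 0

/-- The filtration degree of the operator `opP`. -/
def degP : Fin 4 → ℤ := ![2, 1, 3, 0]

theorem shift_shift_mem {n k : ℤ} (i : Fin 6) (j : Fin 4) (hk : k ≤ n - wtY (.inl i)) {g : Ser}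
    (hg : g ∈ weightGE wtY n) : shift (.inl i) (shift (.inr j) g) ∈ weightGE wtY k := by
  refine weightGE_anti _ ?_ (shift_mem (.inl i) (shift_mem (.inr j) hg))
  simpa [wtY] using hk

theorem opP_sub_leadP_mem (a : Fin 4) {n : ℤ} {g : Ser} (hg : g ∈ weightGE wtY n) :
    opP a g - leadP a g ∈ weightGE wtY (n + degP a + 1) := by
  have h : ∀ i j, n + degP a + 1 ≤ n - wtY (.inl i) →
      shift (.inl i) (shift (.inr j) g) ∈ weightGE wtY (n + degP a + 1) :=
    fun i j hk => shift_shift_mem i j hk hg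
  have hn : ∀ i, degP a + 1 ≤ -wtY (.inl i) → n + degP a + 1 ≤ n - wtY (.inl i) :=
    fun i hi => by linarith
  fin_cases a
  · have e : opP 0 g - leadP 0 g =
        -shift (.inl 1) (shift (.inr 2) g) - shift (.inl 2) (shift (.inr 3) g) := by
      simp [opP, leadP, nablaSer, Fin.sum_univ_four]; abel
    simp only [Fin.zero_eta, e]
    exact sub_mem (neg_mem (h _ _ (hn _ (by decide)))) (h _ _ (hn _ (by decide)))
  · have e : opP 1 g - leadP 1 g =
        shift (.inl 0) (shift (.inr 0) g) - shift (.inl 3) (shift (.inr 2) g) := by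
      simp [opP, leadP, nablaSer, Fin.sum_univ_four]; abel
    simp only [Fin.mk_one, e]
    exact sub_mem (h _ _ (hn _ (by decide))) (h _ _ (hn _ (by decide)))
  · have e : opP 2 g - leadP 2 g =
        shift (.inl 3) (shift (.inr 1) g) - shift (.inl 5) (shift (.inr 3) g) := by
      simp [opP, leadP, nablaSer, Fin.sum_univ_four]; abel
    simp only [Fin.reduceFinMk, e]
    exact sub_mem (h _ _ (hn _ (by decide))) (h _ _ (hn _ (by decide)))
  · have e : opP 3 g - leadP 3 g = shift (.inl 2) (shift (.inr 0) g) +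
        shift (.inl 4) (shift (.inr 1) g) + shift (.inl 5) (shift (.inr 2) g) := by
      simp [opP, leadP, nablaSer, Fin.sum_univ_four]
    simp only [Fin.reduceFinMk, e]
    exact add_mem (add_mem (h _ _ (hn _ (by decide))) (h _ _ (hn _ (by decide))))
      (h _ _ (hn _ (by decide)))

theorem leadP_mem (a : Fin 4) {n : ℤ} {g : Ser} (hg : g ∈ weightGE wtY n) :
    leadP a g ∈ weightGE wtY (n + degP a) := by
  have h : ∀ i j, n + degP a ≤ n - wtY (.inl i) →
      shift (.inl i) (shift (.inr j) g) ∈ weightGE wtY (n + degP a) :=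
    fun i j hk => shift_shift_mem i j hk hg
  fin_cases a
  · exact neg_mem (h 0 1 (by simp [degP, wtY]))
  · exact neg_mem (h 4 3 (by simp [degP, wtY]))
  · exact h 1 0 (by simp [degP, wtY])
  · exact zero_mem _

theorem antiP_mem {j : Fin 4} (hj : j ≠ 3) {n : ℤ} {g : Ser} (hg : g ∈ weightGE wtY n) :
    antiP j g ∈ weightGE wtY (n - degP j) := by
  have h : ∀ i l, n - degP j ≤ n + wtY (.inl i) →
      raise (.inl i) (raise (.inr l) g) ∈ weightGE wtY (n - degP j) := by
    intro i l hk
    refine weightGE_anti _ ?_ (raise_mem (.inl i) (raise_mem (.inr l) hg))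
    simpa [wtY] using hk
  fin_cases j
  · exact neg_mem (h 0 1 (by simp [degP, wtY, sub_eq_add_neg]))
  · exact neg_mem (h 4 3 (by simp [degP, wtY, sub_eq_add_neg]))
  · exact h 1 0 (by simp [degP, wtY, sub_eq_add_neg])
  · exact absurd rfl hj

theorem leadP_antiP_self {j : Fin 4} (hj : j ≠ 3) (g : Ser) : leadP j (antiP j g) = g := by
  fin_cases j
  · simp [leadP, antiP, shift_raise, shift_raise_self]
  · simp [leadP, antiP, shift_raise, shift_raise_self]
  · simp [leadP, antiP, shift_raise, shift_raise_self]
  · exact absurd rfl hj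

theorem leadP_antiP {a j : Fin 4} (haj : a ≠ j) (g : Ser) :
    leadP a (antiP j g) = antiP j (leadP a g) := by
  fin_cases a <;> fin_cases j <;> first
    | exact absurd rfl haj
    | simp [leadP, antiP, shift_raise]

theorem nablaSer_shift (A B : Fin 4) (i : Fin 6 ⊕ Fin 4) (g : Ser) :
    nablaSer A B (shift i g) = shift i (nablaSer A B g) := by
  fin_cases A <;> fin_cases B <;> simp [nablaSer, shift_comm i]

theorem opP_shift (A : Fin 4) (i : Fin 6 ⊕ Fin 4) (g : Ser) :
    opP A (shift i g) = shift i (opP A g) := by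
  simp [opP, map_sum, shift_comm i, nablaSer_shift]

theorem opP_comm (a b : Fin 4) (g : Ser) : opP a (opP b g) = opP b (opP a g) := by
  have h : ∀ A B (g : Ser), opP a (nablaSer A B g) = nablaSer A B (opP a g) := by
    intro A B g
    fin_cases A <;> fin_cases B <;> simp [nablaSer, opP_shift]
  conv_lhs => rw [opP.eq_def b]
  conv_rhs => rw [opP.eq_def b]
  simp [map_sum, h, opP_shift]

theorem weight_nonpos (m : Fin 6 ⊕ Fin 4 → ℕ) : weight wtY m ≤ 0 := by
  refine Finset.sum_nonpos fun i _ => mul_nonpos_of_nonpos_of_nonneg ?_ (Nat.cast_nonneg _)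
  rcases i with i | i
  · fin_cases i <;> simp [wtY]
  · simp [wtY]

theorem koszulData : KoszulData opP antiP degP (weightGE wtY) where
  comm := opP_comm
  nonneg a := by fin_cases a <;> simp [degP]
  anti := weightGE_anti wtY
  one := by
    refine (Submodule.eq_bot_iff _).mpr fun g hg => ?_
    funext m
    exact hg m (by linarith [weight_nonpos m])
  mapP a n g hg := by
    have h := add_mem (weightGE_anti wtY (by linarith) (opP_sub_leadP_mem a hg)) (leadP_mem a hg)
    simpa using h
  mapJ j n g hj hg := antiP_mem hj hg
  mapComm a j n g hj haj hg := by
    have h1 := opP_sub_leadP_mem a (antiP_mem hj hg)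
    have h2 := antiP_mem hj (opP_sub_leadP_mem a hg)
    have h3 := sub_mem (weightGE_anti wtY (show n + degP a - degP j + 1 ≤ _ by linarith) h1)
      (weightGE_anti wtY (show n + degP a - degP j + 1 ≤ _ by linarith) h2)
    rw [map_sub, leadP_antiP haj] at h3
    simpa using h3
  mapInv j n g hj hg := by
    have h1 := neg_mem (opP_sub_leadP_mem j (antiP_mem hj hg))
    rw [leadP_antiP_self hj] at h1
    simpa using h1

end Series

section Exactness

variable {q : ℕ}

/-- The partial derivatives in the variables `z`. -/
def derivZ (C : Fin 4) : Ser →ₗ[ℂ] Ser := shift (.inr C)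

/-- The multiplications by the variables `z`. -/
def mulZ (C : Fin 4) : Ser →ₗ[ℂ] Ser := mulVar (.inr C)

/-- The degree of an exponent in the variables `z`. -/
def degZ (m : Fin 6 ⊕ Fin 4 → ℕ) : ℕ := ∑ c, m (.inr c)

/-- Series homogeneous of degree `p` in the variables `z`. -/
def homZ (p : ℕ) : Submodule ℂ Ser where
  carrier := {g | ∀ m, degZ m ≠ p → g m = 0}
  add_mem' ha hb m hm := by simp [ha m hm, hb m hm]
  zero_mem' _ _ := rfl
  smul_mem' a g hg m hm := by simp [hg m hm]

theorem degZ_add_single_inl (m : Fin 6 ⊕ Fin 4 → ℕ) (i : Fin 6) :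
    degZ (m + Pi.single (.inl i) 1) = degZ m := by
  simp [degZ]

theorem degZ_add_single_inr (m : Fin 6 ⊕ Fin 4 → ℕ) (i : Fin 4) :
    degZ (m + Pi.single (.inr i) 1) = degZ m + 1 := by
  simp only [degZ, Pi.add_apply, Finset.sum_add_distrib, Nat.add_left_cancel_iff]
  rw [Finset.sum_eq_single i]
  · simp
  · intro b _ hb
    rw [Pi.single_eq_of_ne (by simpa using hb)]
  · simp

theorem mulZ_mem {p : ℕ} {g : Ser} (hg : g ∈ homZ p) (C : Fin 4) : mulZ C g ∈ homZ (p + 1) := by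
  intro m hm
  by_cases h : m (.inr C) = 0
  · simp [mulZ, mulVar, h]
  · simp only [mulZ, mulVar, LinearMap.coe_mk, AddHom.coe_mk]
    rw [hg _ ?_, mul_zero]
    rw [← sub_single_add_single h, degZ_add_single_inr] at hm
    omega

theorem opP_mem_homZ {p : ℕ} {g : Ser} (hg : g ∈ homZ (p + 1)) (A : Fin 4) :
    opP A g ∈ homZ p := by
  have hz : ∀ C, shift (.inr C) g ∈ homZ p := fun C m hm =>
    hg _ (by rw [degZ_add_single_inr]; omega)
  have hy : ∀ i {g : Ser}, g ∈ homZ p → shift (.inl i) g ∈ homZ p := fun i g hg m hm =>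
    hg _ (by rwa [degZ_add_single_inl])
  rw [opP, LinearMap.sum_apply]
  refine sum_mem fun B _ => ?_
  rw [LinearMap.comp_apply]
  fin_cases A <;> fin_cases B <;>
    first
      | exact zero_mem _
      | exact hy _ (hz _)
      | exact neg_mem (hy _ (hz _))

theorem wedge_opP_mem_homZ {p : ℕ} {f : (Fin q → Fin 4) → Ser} (hf : ∀ A, f A ∈ homZ (p + 1))
    (A : Fin (q + 1) → Fin 4) : wedge opP f A ∈ homZ p :=
  sum_mem fun _ _ => Submodule.smul_mem _ _ (opP_mem_homZ (hf _) _)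

theorem isBdd_wedge {X : Fin 4 → Ser →ₗ[ℂ] Ser} {d : ℤ} (hX : ∀ a n g, g ∈ weightGE wtY n →
    X a g ∈ weightGE wtY (n + d)) {f : (Fin q → Fin 4) → Ser}
    (hf : IsBdd (weightGE wtY) f) : IsBdd (weightGE wtY) (wedge X f) := by
  obtain ⟨n, hn⟩ := hf
  exact ⟨n + d, fun A => sum_mem fun _ _ => Submodule.smul_mem _ _ (hX _ _ _ (hn _))⟩

theorem isBdd_inter_derivZ {f : (Fin (q + 1) → Fin 4) → Ser}
    (hf : IsBdd (weightGE wtY) f) : IsBdd (weightGE wtY) (inter derivZ f) := by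
  obtain ⟨n, hn⟩ := hf
  refine ⟨n, fun A => sum_mem fun C _ => ?_⟩
  simpa [wtY, derivZ] using shift_mem (.inr C) (hn (Fin.cons C A))

theorem inter_derivZ_wedge_opP (f : (Fin (q + 1) → Fin 4) → Ser) :
    inter derivZ (wedge opP f) = -wedge opP (inter derivZ f) := by
  funext A
  rw [Pi.neg_apply, eq_neg_iff_add_eq_zero, inter_wedge_add_wedge_inter]
  have h : ∀ g, ∑ C, derivZ C (opP C g) = 0 := by
    intro g
    simp [derivZ, opP, nablaSer, Fin.sum_univ_four, shift_comm (.inr _) (.inl _),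
      shift_comm (.inr 3) (.inr _), shift_comm (.inr 2) (.inr 1), shift_comm (.inr 2) (.inr 0),
      shift_comm (.inr 1) (.inr 0)]
    abel
  rw [h]
  simp [derivZ, opP_shift]

theorem inter_derivZ_wedge_mulZ {p : ℕ} {f : (Fin (q + 1) → Fin 4) → Ser} (hf : IsAlt f)
    (hp : ∀ A, f A ∈ homZ p) (h0 : inter derivZ f = 0) :
    inter derivZ (wedge mulZ f) = ((p : ℂ) + 3 - q) • f := by
  funext A
  have h := inter_wedge_add_wedge_inter mulZ derivZ f A
  have hw : wedge mulZ (inter derivZ f) A = 0 := by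
    rw [h0]
    simp [wedge]
  rw [hw, add_zero] at h
  have hc : ∀ i : Fin (q + 1), (-1 : ℂ) ^ (i : ℕ) • ∑ C,
      (mulZ (A i) (derivZ C (f (Fin.cons C (Fin.removeNth i A)))) -
        derivZ C (mulZ (A i) (f (Fin.cons C (Fin.removeNth i A))))) = -f A := by
    intro i
    rw [Finset.sum_eq_single (A i)]
    · rw [← hf.cons_removeNth A i, ← smul_neg]
      congr 1
      funext m
      simp only [mulZ, derivZ, Pi.sub_apply, Pi.neg_apply, shift_mulVar_self, mulVar_shift_self]
      ring
    · intro C _ hC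
      simp only [mulZ, derivZ]
      rw [shift_mulVar (by simpa using hC), sub_self]
    · simp
  rw [h, Finset.sum_congr rfl fun i _ => hc i, Finset.sum_const, Finset.card_univ,
    Fintype.card_fin, ← Nat.cast_smul_eq_nsmul ℂ]
  funext m
  simp only [derivZ, mulZ, Pi.add_apply, Finset.sum_apply, shift_mulVar_self, Finset.sum_const,
    Finset.card_univ, Fintype.card_fin, Pi.smul_apply, Pi.neg_apply, ← Finset.sum_mul,
    Finset.sum_add_distrib, smul_eq_mul]
  by_cases hm : degZ m = p
  · rw [← hm, degZ]
    push_cast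
    ring
  · rw [hp A m hm]
    simp

/-- Contraction-free families are contractions. -/
theorem exists_inter_derivZ_eq {p : ℕ} (hpq : (p : ℂ) + 3 - q ≠ 0)
    {f : (Fin (q + 1) → Fin 4) → Ser} (hf : IsAlt f) (hb : IsBdd (weightGE wtY) f)
    (hp : ∀ A, f A ∈ homZ p) (h0 : inter derivZ f = 0) :
    ∃ g : (Fin (q + 2) → Fin 4) → Ser, IsAlt g ∧ IsBdd (weightGE wtY) g ∧
      (∀ A, g A ∈ homZ (p + 1)) ∧ inter derivZ g = f := by
  have ha : IsAlt (((p : ℂ) + 3 - q)⁻¹ • f) := hf.map (((p : ℂ) + 3 - q)⁻¹ • LinearMap.id)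
  have hp' : ∀ A, (((p : ℂ) + 3 - q)⁻¹ • f) A ∈ homZ p := fun A => Submodule.smul_mem _ _ (hp A)
  have h0' : inter derivZ (((p : ℂ) + 3 - q)⁻¹ • f) = 0 := by
    have : inter derivZ (((p : ℂ) + 3 - q)⁻¹ • f) = ((p : ℂ) + 3 - q)⁻¹ • inter derivZ f := by
      funext A
      simp [inter, Finset.smul_sum]
    rw [this, h0, smul_zero]
  refine ⟨wedge mulZ (((p : ℂ) + 3 - q)⁻¹ • f), isAlt_wedge _ ha, ?_, fun A => ?_, ?_⟩
  · refine isBdd_wedge (d := 0) (fun a n g hg => ?_) ?_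
    · simpa [wtY, mulZ] using mulVar_mem (.inr a) hg
    · obtain ⟨n, hn⟩ := hb
      exact ⟨n, fun A => Submodule.smul_mem _ _ (hn A)⟩
  · exact sum_mem fun _ _ => Submodule.smul_mem _ _ (mulZ_mem (hp' _) _)
  · rw [inter_derivZ_wedge_mulZ ha hp' h0', smul_smul, mul_inv_cancel₀ hpq, one_smul]

theorem IsAlt.eq_zero_of_five {g : (Fin 5 → Fin 4) → Ser} (hg : IsAlt g) : g = 0 := by
  funext A
  refine hg.eq_zero fun h => ?_
  simpa using Fintype.card_le_of_injective A h

theorem eq_zero_of_inter_derivZ {p : ℕ} (hp0 : p ≠ 0) {f : (Fin 4 → Fin 4) → Ser} (hf : IsAlt f)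
    (hb : IsBdd (weightGE wtY) f) (hp : ∀ A, f A ∈ homZ p) (h0 : inter derivZ f = 0) : f = 0 := by
  obtain ⟨g, ga, -, -, hg⟩ := exists_inter_derivZ_eq (by simpa using hp0) hf hb hp h0
  rw [← hg, ga.eq_zero_of_five]
  funext A
  simp [inter]

theorem derivZ_comm (a b : Fin 4) (g : Ser) : derivZ a (derivZ b g) = derivZ b (derivZ a g) :=
  shift_comm _ _ g

theorem isBdd_wedge_opP {f : (Fin q → Fin 4) → Ser} (hf : IsBdd (weightGE wtY) f) :
    IsBdd (weightGE wtY) (wedge opP f) :=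
  isBdd_wedge (d := 0) (fun a _ _ hg => weightGE_anti _
    (by linarith [koszulData.nonneg a]) (koszulData.mapP a _ _ hg)) hf

theorem IsAlt.neg {f : (Fin q → Fin 4) → Ser} (hf : IsAlt f) : IsAlt (-f) :=
  hf.map (-LinearMap.id)

theorem IsBdd.neg {f : (Fin q → Fin 4) → Ser} (hf : IsBdd (weightGE wtY) f) :
    IsBdd (weightGE wtY) (-f) :=
  hf.imp fun _ hn A => neg_mem (hn A)

theorem wedge_neg (X : Fin 4 → Ser →ₗ[ℂ] Ser) (f : (Fin q → Fin 4) → Ser) :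
    wedge X (-f) = -wedge X f := by
  funext A
  simp [wedge]

theorem inter_neg (X : Fin 4 → Ser →ₗ[ℂ] Ser) (f : (Fin (q + 1) → Fin 4) → Ser) :
    inter X (-f) = -inter X f := by
  funext A
  simp [inter]

theorem inter_add (X : Fin 4 → Ser →ₗ[ℂ] Ser) (f g : (Fin (q + 1) → Fin 4) → Ser) :
    inter X (f + g) = inter X f + inter X g := by
  funext A
  simp [inter, Finset.sum_add_distrib]

/-- A family that is the contraction of an exact one is exact. -/
theorem exists_of_eq_inter_derivZ {f : (Fin (q + 1) → Fin 4) → Ser}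
    {g : (Fin (q + 2) → Fin 4) → Ser} (ga : IsAlt g) (gb : IsBdd (weightGE wtY) g)
    (g0 : wedge opP g = 0) (hg : inter derivZ g = f) :
    ∃ u : (Fin (q + 1) → Fin 4) → Ser, IsAlt u ∧ IsBdd (weightGE wtY) u ∧
      wedge opP (-inter derivZ u) = f := by
  obtain ⟨u, ua, ub, hu⟩ := exists_wedge_eq koszulData ga gb g0
  refine ⟨u, ua, ub, ?_⟩
  rw [wedge_neg, ← inter_derivZ_wedge_opP, hu, hg]

theorem cast_add_three_sub_ne_zero (p : ℕ) {q : ℕ} (hq : q ≤ 2) : (p : ℂ) + 3 - q ≠ 0 := by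
  rw [sub_ne_zero]
  exact_mod_cast (show p + 3 ≠ q by omega)

theorem series_exact_three {p : ℕ} {f : (Fin 3 → Fin 4) → Ser} (hf : IsAlt f)
    (hb : IsBdd (weightGE wtY) f) (hp : ∀ A, f A ∈ homZ p) (h0 : inter derivZ f = 0) :
    ∃ u : (Fin 2 → Fin 4) → Ser, IsAlt u ∧ IsBdd (weightGE wtY) u ∧ inter derivZ u = 0 ∧
      wedge opP u = f := by
  obtain ⟨g, ga, gb, -, hg⟩ := exists_inter_derivZ_eq
    (cast_add_three_sub_ne_zero p (by norm_num)) hf hb hp h0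
  obtain ⟨u, ua, ub, hu⟩ := exists_of_eq_inter_derivZ ga gb (isAlt_wedge _ ga).eq_zero_of_five hg
  exact ⟨_, (ua.inter _).neg, (isBdd_inter_derivZ ub).neg, by
    rw [inter_neg, inter_inter _ derivZ_comm ua, neg_zero], hu⟩

theorem series_exact_two {p : ℕ} (hp0 : p ≠ 0) {f : (Fin 2 → Fin 4) → Ser} (hf : IsAlt f)
    (hb : IsBdd (weightGE wtY) f) (hp : ∀ A, f A ∈ homZ p) (h0 : inter derivZ f = 0)
    (hD : wedge opP f = 0) :
    ∃ u : (Fin 1 → Fin 4) → Ser, IsAlt u ∧ IsBdd (weightGE wtY) u ∧ inter derivZ u = 0 ∧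
      wedge opP u = f := by
  obtain ⟨g, ga, gb, gp, hg⟩ := exists_inter_derivZ_eq
    (cast_add_three_sub_ne_zero p (by norm_num)) hf hb hp h0
  have g0 : wedge opP g = 0 := eq_zero_of_inter_derivZ hp0 (isAlt_wedge _ ga) (isBdd_wedge_opP gb)
    (wedge_opP_mem_homZ gp) (by rw [inter_derivZ_wedge_opP, hg, hD, neg_zero])
  obtain ⟨u, ua, ub, hu⟩ := exists_of_eq_inter_derivZ ga gb g0 hg
  exact ⟨_, (ua.inter _).neg, (isBdd_inter_derivZ ub).neg, by
    rw [inter_neg, inter_inter _ derivZ_comm ua, neg_zero], hu⟩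

theorem series_exact_one {p : ℕ} {f : (Fin 1 → Fin 4) → Ser} (hf : IsAlt f)
    (hb : IsBdd (weightGE wtY) f) (hp : ∀ A, f A ∈ homZ p) (h0 : inter derivZ f = 0)
    (hD : wedge opP f = 0) :
    ∃ u : (Fin 0 → Fin 4) → Ser, IsAlt u ∧ IsBdd (weightGE wtY) u ∧ wedge opP u = f := by
  obtain ⟨g, ga, gb, gp, hg⟩ := exists_inter_derivZ_eq
    (cast_add_three_sub_ne_zero p (by norm_num)) hf hb hp h0
  obtain ⟨h, ha, hb, hp', hh⟩ := exists_inter_derivZ_eq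
    (cast_add_three_sub_ne_zero p (by norm_num)) (isAlt_wedge opP ga) (isBdd_wedge_opP gb)
    (wedge_opP_mem_homZ gp) (by rw [inter_derivZ_wedge_opP, hg, hD, neg_zero])
  obtain ⟨v, va, vb, hv⟩ := exists_of_eq_inter_derivZ ha hb (isAlt_wedge _ ha).eq_zero_of_five hh
  obtain ⟨u, ua, ub, hu⟩ := exists_of_eq_inter_derivZ (f := f) (g := g + inter derivZ v)
    (ga.add (va.inter _)) (gb.add koszulData.anti (isBdd_inter_derivZ vb))
    (by rw [wedge_neg] at hv; rw [wedge_add, ← hv, neg_add_cancel])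
    (by rw [inter_add, inter_inter _ derivZ_comm va, hg, add_zero])
  exact ⟨_, (ua.inter _).neg, (isBdd_inter_derivZ ub).neg, hu⟩

end Exactness

section PolynomialFunctions

open MvPolynomial

/-- The matrix of the linear coordinates `y^{12}, y^{13}, y^{14}, y^{23}, y^{24}, y^{34}` on `ℂ⁶`
dual to the vector fields `∇^{12}, ∇^{13}, ∇^{14}, ∇^{23}, ∇^{24}, ∇^{34}`. -/
def coordMatrix : Fin 6 → Fin 6 → ℂ :=
  ![![-Complex.I / 2, 0, 0, 0, 0, 1 / 2], ![0, 0, 0, 1 / 2, -Complex.I / 2, 0],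
    ![0, 1 / 2, -Complex.I / 2, 0, 0, 0], ![0, 1 / 2, Complex.I / 2, 0, 0, 0],
    ![0, 0, 0, -1 / 2, -Complex.I / 2, 0], ![Complex.I / 2, 0, 0, 0, 0, 1 / 2]]

/-- The coordinates `y` as functions of the coordinates `x`. -/
def yCoord (w : Fin 6 → ℂ) (i : Fin 6) : ℂ := ∑ j, coordMatrix i j * w j

/-- The coordinates `x` as functions of the coordinates `y`. -/
def xCoord (y : Fin 6 → ℂ) : Fin 6 → ℂ :=
  ![Complex.I * (y 0 - y 5), y 2 + y 3, Complex.I * (y 2 - y 3), y 1 - y 4,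
    Complex.I * (y 1 + y 4), y 0 + y 5]

theorem yCoord_xCoord (y : Fin 6 → ℂ) : yCoord (xCoord y) = y := by
  funext i
  fin_cases i <;> simp [yCoord, xCoord, coordMatrix, Fin.sum_univ_six] <;> ring_nf <;>
    simp <;> ring

theorem xCoord_yCoord (w : Fin 6 → ℂ) : xCoord (yCoord w) = w := by
  funext i
  fin_cases i <;> simp [yCoord, xCoord, coordMatrix, Fin.sum_univ_six] <;> ring_nf <;>
    simp

/-- The function on `ℝ⁶` given by a polynomial in the coordinates `y`. -/
def evalY (Q : MvPolynomial (Fin 6) ℂ) (x : Pt) : ℂ := eval (yCoord fun j => (x j : ℂ)) Q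

theorem exists_eval_yCoord (Q : MvPolynomial (Fin 6) ℂ) :
    ∃ P : MvPolynomial (Fin 6) ℂ, ∀ w, eval (yCoord w) Q = eval w P :=
  ⟨bind₁ (fun i => ∑ j, C (coordMatrix i j) * X j) Q, fun w => by
    simp only [eval, eval₂Hom_bind₁]
    congr 2
    funext i
    simp [yCoord]⟩

theorem exists_eval_xCoord (P : MvPolynomial (Fin 6) ℂ) :
    ∃ Q : MvPolynomial (Fin 6) ℂ, ∀ y, eval (xCoord y) P = eval y Q :=
  ⟨bind₁ (![C Complex.I * (X 0 - X 5), X 2 + X 3, C Complex.I * (X 2 - X 3), X 1 - X 4,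
    C Complex.I * (X 1 + X 4), X 0 + X 5]) P, fun y => by
    simp only [eval, eval₂Hom_bind₁]
    congr 2
    funext i
    fin_cases i <;> simp [xCoord]⟩

theorem evalY_injective : Function.Injective evalY := by
  intro Q Q' h
  obtain ⟨P, hP⟩ := exists_eval_yCoord Q
  obtain ⟨P', hP'⟩ := exists_eval_yCoord Q'
  have hPP : P = P' := by
    refine funext_set (fun _ => Set.range ((↑) : ℝ → ℂ))
      (fun _ => Set.infinite_range_of_injective Complex.ofReal_injective) fun w hw => ?_
    choose x hx using fun i => hw i trivial
    have hx : (fun i => (x i : ℂ)) = w := _root_.funext hx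
    have hQ := congrFun h x
    rwa [evalY, evalY, hx, hP, hP'] at hQ
  refine MvPolynomial.funext fun y => ?_
  rw [← yCoord_xCoord y, hP, hP', hPP]

/-- The differential of the coordinate `y i`. -/
def dY (i : Fin 6) : Pt →L[ℝ] ℂ :=
  ∑ j, coordMatrix i j • Complex.ofRealCLM.comp (ContinuousLinearMap.proj j)

theorem evalY_X (i : Fin 6) (x : Pt) : evalY (X i) x = dY i x := by
  simp [evalY, yCoord, dY]

theorem hasFDerivAt_evalY (Q : MvPolynomial (Fin 6) ℂ) (x : Pt) :
    HasFDerivAt (evalY Q) (∑ i, evalY (pderiv i Q) x • dY i) x := by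
  induction Q using MvPolynomial.induction_on with
  | C a =>
    have : evalY (C a) = fun _ => a := by
      funext x
      simp [evalY]
    rw [this]
    refine (hasFDerivAt_const (𝕜 := ℝ) a x).congr_fderiv ?_
    ext v
    simp [evalY]
  | add p q hp hq =>
    have e : evalY (p + q) = evalY p + evalY q := by
      funext x
      simp [evalY]
    rw [e]
    refine (hp.add hq).congr_fderiv ?_
    ext v
    simp [evalY, add_mul, Finset.sum_add_distrib]
  | mul_X p n hp =>
    have hX : HasFDerivAt (evalY (X n)) (dY n) x := by
      rw [_root_.funext (evalY_X n)]
      exact (dY n).hasFDerivAt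
    have e : evalY (p * X n) = evalY p * evalY (X n) := by
      funext x
      simp [evalY]
    rw [e]
    refine (hp.mul hX).congr_fderiv ?_
    ext v
    have hs : ∀ i, evalY (pderiv i (p * X n)) x =
        evalY (X n) x * evalY (pderiv i p) x + evalY p x * if n = i then 1 else 0 := by
      intro i
      by_cases hi : n = i
      · subst hi
        simp [evalY, mul_comm, add_comm]
      · simp [evalY, pderiv_X_of_ne hi, hi, mul_comm]
    simp [-Derivation.leibniz, hs, add_mul, Finset.sum_add_distrib, mul_assoc, Finset.mul_sum,
      add_comm]

theorem pd_evalY (j : Fin 6) (Q : MvPolynomial (Fin 6) ℂ) (x : Pt) :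
    pd j (evalY Q) x = ∑ i, evalY (pderiv i Q) x * coordMatrix i j := by
  have h : ∀ i, dY i (Pi.single j 1) = coordMatrix i j := by
    intro i
    simp [dY, Pi.single_apply, apply_ite Complex.ofReal]
  simp [pd, (hasFDerivAt_evalY Q x).fderiv, h]

/-- The operator `∇^{AB}` on polynomials in the coordinates `y`. -/
def nablaPoly : Fin 4 → Fin 4 → MvPolynomial (Fin 6) ℂ → MvPolynomial (Fin 6) ℂ :=
  ![![0, pderiv 0, pderiv 1, pderiv 2], ![-pderiv 0, 0, pderiv 3, pderiv 4],
    ![-pderiv 1, -pderiv 3, 0, pderiv 5], ![-pderiv 2, -pderiv 4, -pderiv 5, 0]]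

theorem nabla_evalY (A B : Fin 4) (Q : MvPolynomial (Fin 6) ℂ) :
    nabla A B (evalY Q) = evalY (nablaPoly A B Q) := by
  funext x
  simp only [nabla, pd_evalY]
  fin_cases A <;> fin_cases B <;>
    simp [nablaCoeff, coordMatrix, nablaPoly, Fin.sum_univ_six, evalY] <;> ring_nf <;>
    simp <;> ring

/-- The family of partial derivatives at the origin of a polynomial. -/
def taylor (Q : MvPolynomial (Fin 6) ℂ) (m : Fin 6 → ℕ) : ℂ :=
  (∏ i, ((m i).factorial : ℂ)) * coeff (Finsupp.equivFunOnFinite.symm m) Q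

theorem prod_factorial_ne_zero (m : Fin 6 → ℕ) : (∏ i, ((m i).factorial : ℂ)) ≠ 0 :=
  Finset.prod_ne_zero_iff.mpr fun _ _ => Nat.cast_ne_zero.mpr (Nat.factorial_ne_zero _)

theorem taylor_injective : Function.Injective taylor := by
  intro Q Q' h
  ext s
  have hs := congrFun h (Finsupp.equivFunOnFinite s)
  simpa [taylor, -Finsupp.equivFunOnFinite_apply, prod_factorial_ne_zero] using hs

theorem taylor_pderiv (i : Fin 6) (Q : MvPolynomial (Fin 6) ℂ) (m : Fin 6 → ℕ) :
    taylor (pderiv i Q) m = taylor Q (m + Pi.single i 1) := by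
  have hs : Finsupp.equivFunOnFinite.symm (m + Pi.single i 1) =
      Finsupp.equivFunOnFinite.symm m + Finsupp.single i 1 := by
    ext l
    simp [Finsupp.single_apply, Pi.single_apply, eq_comm]
  have hp : (∏ l, (((m + Pi.single i 1 : Fin 6 → ℕ) l).factorial : ℂ)) =
      (m i + 1) * ∏ l, ((m l).factorial : ℂ) := by
    rw [← Finset.mul_prod_erase _ _ (Finset.mem_univ i),
      ← Finset.mul_prod_erase (f := fun l => ((m l).factorial : ℂ)) _ (Finset.mem_univ i)]
    rw [Finset.prod_congr rfl (g := fun l => ((m l).factorial : ℂ)) fun l hl => by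
      simp [Pi.single_eq_of_ne (Finset.ne_of_mem_erase hl)]]
    simp [Nat.factorial_succ, mul_assoc]
  rw [taylor, taylor, hs, hp, coeff_pderiv]
  simp
  ring

theorem exists_taylor_eq {g : (Fin 6 → ℕ) → ℂ} (hg : (Function.support g).Finite) :
    ∃ Q, taylor Q = g := by
  refine ⟨∑ s ∈ hg.toFinset, monomial (Finsupp.equivFunOnFinite.symm s)
    ((∏ i, ((s i).factorial : ℂ))⁻¹ * g s), ?_⟩
  funext m
  simp only [taylor, coeff_sum, coeff_monomial, EmbeddingLike.apply_eq_iff_eq]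
  rw [Finset.sum_ite_eq']
  split_ifs with h
  · rw [mul_inv_cancel_left₀ (prod_factorial_ne_zero m)]
  · simpa [eq_comm] using h

end PolynomialFunctions

section Representation

open MvPolynomial

variable {p q : ℕ}

/-- `φ` is a polynomial function with Taylor coefficients `g` in the coordinates `y`. -/
def HasTaylor (φ : Pt → ℂ) (g : (Fin 6 → ℕ) → ℂ) : Prop := ∃ Q, evalY Q = φ ∧ taylor Q = g

theorem HasTaylor.left_unique {φ ψ : Pt → ℂ} {g : (Fin 6 → ℕ) → ℂ} (h : HasTaylor φ g)
    (h' : HasTaylor ψ g) : φ = ψ := by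
  obtain ⟨Q, rfl, rfl⟩ := h
  obtain ⟨Q', rfl, hQ⟩ := h'
  rw [taylor_injective hQ]

theorem HasTaylor.right_unique {φ : Pt → ℂ} {g g' : (Fin 6 → ℕ) → ℂ} (h : HasTaylor φ g)
    (h' : HasTaylor φ g') : g = g' := by
  obtain ⟨Q, rfl, rfl⟩ := h
  obtain ⟨Q', hQ, rfl⟩ := h'
  rw [evalY_injective hQ]

theorem hasTaylor_zero : HasTaylor (fun _ => 0) fun _ => 0 :=
  ⟨0, by funext x; simp [evalY], by funext m; simp [taylor]⟩

theorem HasTaylor.add {φ ψ : Pt → ℂ} {g h : (Fin 6 → ℕ) → ℂ} (hφ : HasTaylor φ g)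
    (hψ : HasTaylor ψ h) : HasTaylor (fun x => φ x + ψ x) fun m => g m + h m := by
  obtain ⟨Q, rfl, rfl⟩ := hφ
  obtain ⟨R, rfl, rfl⟩ := hψ
  exact ⟨Q + R, by funext x; simp [evalY], by funext m; simp [taylor, mul_add]⟩

theorem HasTaylor.mul_left {φ : Pt → ℂ} {g : (Fin 6 → ℕ) → ℂ} (hφ : HasTaylor φ g) (a : ℂ) :
    HasTaylor (fun x => a * φ x) fun m => a * g m := by
  obtain ⟨Q, rfl, rfl⟩ := hφ
  exact ⟨C a * Q, by funext x; simp [evalY], by funext m; simp [taylor, mul_left_comm]⟩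

theorem HasTaylor.sum {ι : Type*} (s : Finset ι) {φ : ι → Pt → ℂ} {g : ι → (Fin 6 → ℕ) → ℂ}
    (h : ∀ i, HasTaylor (φ i) (g i)) :
    HasTaylor (fun x => ∑ i ∈ s, φ i x) fun m => ∑ i ∈ s, g i m := by
  classical
  induction s using Finset.induction_on with
  | empty => simpa using hasTaylor_zero
  | insert a s ha ih => simpa [Finset.sum_insert ha] using (h a).add ih

theorem shift_inl_elim (i : Fin 6) (g : Ser) (m : Fin 6 → ℕ) (n : Fin 4 → ℕ) :
    shift (.inl i) g (Sum.elim m n) = g (Sum.elim (m + Pi.single i 1) n) := by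
  simp only [shift, LinearMap.coe_mk, AddHom.coe_mk]
  congr 1
  funext l
  rcases l with l | l <;> simp [Pi.single_apply]

theorem shift_inr_elim (c : Fin 4) (g : Ser) (m : Fin 6 → ℕ) (n : Fin 4 → ℕ) :
    shift (.inr c) g (Sum.elim m n) = g (Sum.elim m (n + Pi.single c 1)) := by
  simp only [shift, LinearMap.coe_mk, AddHom.coe_mk]
  congr 1
  funext l
  rcases l with l | l <;> simp [Pi.single_apply]

theorem HasTaylor.nabla {φ : Pt → ℂ} {g : Ser} {n : Fin 4 → ℕ}
    (h : HasTaylor φ fun m => g (Sum.elim m n)) (A B : Fin 4) :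
    HasTaylor (nabla A B φ) fun m => nablaSer A B g (Sum.elim m n) := by
  obtain ⟨Q, rfl, hQ⟩ := h
  refine ⟨nablaPoly A B Q, (nabla_evalY A B Q).symm, ?_⟩
  have hp : ∀ i, taylor (pderiv i Q) = fun m => shift (.inl i) g (Sum.elim m n) := by
    intro i
    funext m
    rw [taylor_pderiv, hQ, shift_inl_elim]
  have hn : ∀ R, taylor (-R) = -taylor R := by
    intro R
    funext m
    simp [taylor]
  have h0 : taylor 0 = 0 := by
    funext m
    simp [taylor]
  fin_cases A <;> fin_cases B <;> simp [nablaPoly, nablaSer, hp, hn, h0, Pi.neg_def, Pi.zero_def]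

/-- The number of occurrences of each index in a tuple. -/
def indexCount (B : Fin p → Fin 4) (c : Fin 4) : ℕ := ∑ i, if B i = c then 1 else 0

theorem indexCount_cons (c : Fin 4) (B : Fin p → Fin 4) :
    indexCount (Fin.cons c B : Fin (p + 1) → Fin 4) = indexCount B + Pi.single c 1 := by
  funext d
  rw [indexCount, Fin.sum_univ_succ, add_comm]
  simp [indexCount, Pi.single_apply, eq_comm (a := c)]

theorem indexCount_snoc (c : Fin 4) (B : Fin p → Fin 4) :
    indexCount (Fin.snoc B c : Fin (p + 1) → Fin 4) = indexCount B + Pi.single c 1 := by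
  funext d
  rw [indexCount, Fin.sum_univ_castSucc]
  simp [indexCount, Pi.single_apply, eq_comm (a := c)]

theorem indexCount_comp (B : Fin p → Fin 4) (σ : Equiv.Perm (Fin p)) :
    indexCount (B ∘ σ) = indexCount B := by
  funext d
  exact Equiv.sum_comp σ fun i => if B i = d then 1 else 0

theorem sum_indexCount (B : Fin p → Fin 4) : ∑ c, indexCount B c = p := by
  simp only [indexCount]
  rw [Finset.sum_comm]
  simp

theorem exists_indexCount_eq {n : Fin 4 → ℕ} (hn : ∑ c, n c = p) :
    ∃ B : Fin p → Fin 4, indexCount B = n := by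
  induction p generalizing n with
  | zero =>
    refine ⟨Fin.elim0, ?_⟩
    funext c
    have := (Finset.sum_eq_zero_iff.mp hn) c (Finset.mem_univ c)
    simp [indexCount, this]
  | succ p ih =>
    obtain ⟨c, -, hc⟩ := Finset.exists_ne_zero_of_sum_ne_zero (by rw [hn]; exact p.succ_ne_zero)
    have he : n = n - Pi.single c 1 + Pi.single c 1 := by
      funext d
      by_cases hd : d = c
      · subst hd
        simp only [Pi.add_apply, Pi.sub_apply, Pi.single_eq_same]
        omega
      · simp [Pi.single_eq_of_ne hd]
    obtain ⟨B, hB⟩ := ih (n := n - Pi.single c 1) (by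
      rw [he] at hn
      simpa [Finset.sum_add_distrib] using hn)
    exact ⟨Fin.cons c B, by rw [indexCount_cons, hB, ← he]⟩

theorem exists_perm_of_indexCount_eq {B B' : Fin p → Fin 4} (h : indexCount B = indexCount B') :
    ∃ σ : Equiv.Perm (Fin p), B' ∘ σ = B := by
  have hc : ∀ c, Fintype.card {i // B i = c} = Fintype.card {i // B' i = c} := by
    intro c
    simpa [indexCount, Fintype.card_subtype] using congrFun h c
  exact ⟨Equiv.ofFiberEquiv fun c => Fintype.equivOfCardEq (hc c),
    _root_.funext fun i => Equiv.ofFiberEquiv_map _ i⟩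

/-- The tensor-valued polynomial `f` has generating series `F`. -/
def HasSeries (f : Pt → Tens q p) (F : (Fin q → Fin 4) → Ser) : Prop :=
  ∀ A B, HasTaylor (fun x => f x A B) fun m => F A (Sum.elim m (indexCount B))

theorem HasSeries.left_unique {f g : Pt → Tens q p} {F : (Fin q → Fin 4) → Ser}
    (hf : HasSeries f F) (hg : HasSeries g F) (x : Pt) (A : Fin q → Fin 4) (B : Fin p → Fin 4) :
    f x A B = g x A B :=
  congrFun ((hf A B).left_unique (hg A B)) x

theorem hasSeries_zero : HasSeries (fun _ _ _ => 0 : Pt → Tens q p) 0 :=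
  fun _ _ => hasTaylor_zero

theorem HasSeries.right_unique {f : Pt → Tens q p} {F G : (Fin q → Fin 4) → Ser}
    (hF : HasSeries f F) (hG : HasSeries f G) (pF : ∀ A, F A ∈ homZ p) (pG : ∀ A, G A ∈ homZ p) :
    F = G := by
  funext A m
  by_cases hm : degZ m = p
  · obtain ⟨B, hB⟩ := exists_indexCount_eq hm
    have h := congrFun ((hF A B).right_unique (hG A B)) (m ∘ Sum.inl)
    have he : Sum.elim (m ∘ Sum.inl) (indexCount B) = m := by
      rw [hB]
      exact Sum.elim_comp_inl_inr m
    simpa only [he] using h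
  · rw [pF A m hm, pG A m hm]

theorem HasSeries.symSub {f : Pt → Tens q p} {F : (Fin q → Fin 4) → Ser}
    (hF : HasSeries f F) (x : Pt) : SymSub (f x) := by
  intro A σ B
  have h := hF A (B ∘ σ)
  rw [indexCount_comp] at h
  exact congrFun (h.left_unique (hF A B)) x

theorem HasSeries.antiSup {f : Pt → Tens q p} {F : (Fin q → Fin 4) → Ser}
    (hF : HasSeries f F) (ha : IsAlt F) (x : Pt) : AntiSup (f x) := by
  intro σ A B
  have h := hF (A ∘ σ) B
  rw [ha] at h
  exact congrFun (h.left_unique ((hF A B).mul_left _)) x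

theorem HasSeries.isPolyMap {f : Pt → Tens q p} {F : (Fin q → Fin 4) → Ser}
    (hF : HasSeries f F) : IsPolyMap f := by
  intro A B
  obtain ⟨Q, hQ, -⟩ := hF A B
  obtain ⟨P, hP⟩ := exists_eval_yCoord Q
  exact ⟨P, fun x => by rw [← hP]; exact (congrFun hQ x).symm⟩

theorem HasSeries.contr {f : Pt → Tens (q + 1) (p + 1)} {F : (Fin (q + 1) → Fin 4) → Ser}
    (hF : HasSeries f F) : HasSeries (fun x => contr (f x)) (inter derivZ F) := by
  intro A B
  have h := HasTaylor.sum Finset.univ fun C : Fin 4 => hF (Fin.cons C A) (Fin.snoc B C)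
  simpa [_root_.contr, inter, derivZ, shift_inr_elim, indexCount_snoc] using h

theorem HasSeries.dop {f : Pt → Tens q (p + 1)} {F : (Fin q → Fin 4) → Ser}
    (hF : HasSeries f F) (ha : IsAlt F) :
    HasSeries (fun x => Dop f x) (((q : ℂ) + 1)⁻¹ • wedge opP F) := by
  intro A B
  have hσ : ∀ σ : Equiv.Perm (Fin (q + 1)), HasTaylor
      (fun x => ∑ B₁, nabla B₁ (A (σ 0)) (fun y => f y (Fin.tail (A ∘ σ)) (Fin.cons B₁ B)) x)
      fun m => opP (A (σ 0)) (F (Fin.tail (A ∘ σ))) (Sum.elim m (indexCount B)) := by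
    intro σ
    have h := HasTaylor.sum Finset.univ fun B₁ : Fin 4 => HasTaylor.nabla (n := indexCount B)
      (g := shift (.inr B₁) (F (Fin.tail (A ∘ σ))))
      (by simpa [shift_inr_elim, indexCount_cons] using hF (Fin.tail (A ∘ σ)) (Fin.cons B₁ B))
      B₁ (A (σ 0))
    simpa [opP] using h
  have h := (HasTaylor.sum Finset.univ fun σ =>
    (hσ σ).mul_left ((Equiv.Perm.sign σ : ℤ) : ℂ)).mul_left (((q + 1).factorial : ℂ)⁻¹)
  have e : (fun m => ((((q : ℂ) + 1)⁻¹ • wedge opP F) A) (Sum.elim m (indexCount B))) = fun m =>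
      ((q + 1).factorial : ℂ)⁻¹ * ∑ σ : Equiv.Perm (Fin (q + 1)),
        ((Equiv.Perm.sign σ : ℤ) : ℂ) *
          opP (A (σ 0)) (F (Fin.tail (A ∘ σ))) (Sum.elim m (indexCount B)) := by
    funext m
    have hs := congrFun (sum_perm_eq_wedge opP ha A) (Sum.elim m (indexCount B))
    simp only [Finset.sum_apply, Pi.smul_apply, smul_eq_mul] at hs
    rw [hs]
    have hq : (q.factorial : ℂ) ≠ 0 := Nat.cast_ne_zero.mpr q.factorial_ne_zero
    simp only [Pi.smul_apply, smul_eq_mul, Nat.factorial_succ, Nat.cast_mul, mul_inv]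
    push_cast
    field_simp
  rw [e]
  exact h

theorem isBdd_of_finite {F : (Fin q → Fin 4) → Ser}
    (h : ∀ A, (Function.support (F A)).Finite) : IsBdd (weightGE wtY) F := by
  have hfin : (⋃ A, weight wtY '' Function.support (F A)).Finite :=
    Set.finite_iUnion fun A => (h A).image _
  obtain ⟨n, hn⟩ := hfin.bddBelow
  refine ⟨n, fun A m hm => ?_⟩
  by_contra h0
  exact absurd (hn (Set.mem_iUnion.mpr ⟨A, m, h0, rfl⟩)) (not_le.mpr hm)

/-- Every symmetric tensor-valued polynomial has a generating series. -/
theorem exists_hasSeries {f : Pt → Tens q p} (hf : IsPolyMap f) (hs : ∀ x, SymSub (f x))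
    (ha : ∀ x, AntiSup (f x)) :
    ∃ F : (Fin q → Fin 4) → Ser, HasSeries f F ∧ IsAlt F ∧ IsBdd (weightGE wtY) F ∧
      ∀ A, F A ∈ homZ p := by
  classical
  have hQ : ∀ A B, ∃ Q, evalY Q = fun x => f x A B := by
    intro A B
    obtain ⟨P, hP⟩ := hf A B
    obtain ⟨Q, hQ⟩ := exists_eval_xCoord P
    refine ⟨Q, _root_.funext fun x => ?_⟩
    rw [hP, evalY, ← hQ, xCoord_yCoord]
  choose Q hQ using hQ
  have hcount : ∀ A B B', indexCount B = indexCount B' → Q A B = Q A B' := by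
    intro A B B' h
    obtain ⟨σ, rfl⟩ := exists_perm_of_indexCount_eq h
    exact evalY_injective (by rw [hQ, hQ]; exact _root_.funext fun x => hs x A σ B')
  let F : (Fin q → Fin 4) → Ser := fun A m =>
    if h : ∃ B : Fin p → Fin 4, indexCount B = m ∘ Sum.inr then
      taylor (Q A h.choose) (m ∘ Sum.inl) else 0
  have hF : ∀ A B m, F A (Sum.elim m (indexCount B)) = taylor (Q A B) m := by
    intro A B m
    have h : ∃ B' : Fin p → Fin 4, indexCount B' = Sum.elim m (indexCount B) ∘ Sum.inr :=
      ⟨B, rfl⟩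
    have hB : indexCount h.choose = indexCount B := h.choose_spec
    simp only [F, dif_pos h]
    rw [hcount A _ _ hB]
    rfl
  have hS : HasSeries f F := fun A B => ⟨Q A B, hQ A B, _root_.funext fun m => (hF A B m).symm⟩
  have hp : ∀ A, F A ∈ homZ p := by
    intro A m hm
    refine dif_neg ?_
    rintro ⟨B, hB⟩
    refine hm ?_
    rw [← sum_indexCount B, hB]
    rfl
  refine ⟨F, hS, ?_, isBdd_of_finite fun A => ?_, hp⟩
  · intro σ
    have h1 : HasSeries (fun x A B => f x (A ∘ σ) B) fun A => F (A ∘ σ) := fun A B => hS (A ∘ σ) B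
    have h2 : HasSeries (fun x A B => f x (A ∘ σ) B) (((Equiv.Perm.sign σ : ℤ) : ℂ) • F) := by
      intro A B
      simp only [ha _ σ]
      exact (hS A B).mul_left _
    exact congrFun (h1.right_unique h2 (fun A => hp _) fun A => Submodule.smul_mem _ _ (hp A))
  · refine (Set.finite_iUnion fun B : Fin p → Fin 4 => (Q A B).support.finite_toSet.image
      fun s : Fin 6 →₀ ℕ => Sum.elim s (indexCount B)).subset ?_
    intro m hm
    by_cases hd : degZ m = p
    · obtain ⟨B, hB⟩ := exists_indexCount_eq hd
      have he : Sum.elim (m ∘ Sum.inl) (indexCount B) = m := by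
        rw [hB]
        exact Sum.elim_comp_inl_inr m
      rw [← he] at hm ⊢
      rw [Function.mem_support, hF] at hm
      refine Set.mem_iUnion.mpr ⟨B, Finsupp.equivFunOnFinite.symm (m ∘ Sum.inl), ?_, rfl⟩
      exact mem_support_iff.mpr (right_ne_zero_of_mul hm)
    · exact absurd (hp A m hd) hm

theorem le_of_weightGE {n : ℤ} {g : Ser} (hg : g ∈ weightGE wtY n) {m : Fin 6 → ℕ}
    {r : Fin 4 → ℕ} (h : g (Sum.elim m r) ≠ 0) (i : Fin 6) : m i ≤ (-n).toNat := by
  have hw : n ≤ weight wtY (Sum.elim m r) := not_lt.mp fun hlt => h (hg _ hlt)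
  have e : weight wtY (Sum.elim m r) =
      -(2 * m 0 + 3 * m 1 + 4 * m 2 + 4 * m 3 + m 4 + 4 * m 5) := by
    simp [weight, wtY, Fin.sum_univ_six]
    ring
  rw [e] at hw
  fin_cases i <;> simp only [Fin.zero_eta, Fin.mk_one, Fin.reduceFinMk] <;> omega

/-- Every bounded family of series is a generating series. -/
theorem exists_hasSeries_of_isBdd (p : ℕ) {F : (Fin q → Fin 4) → Ser}
    (hF : IsBdd (weightGE wtY) F) : ∃ f : Pt → Tens q p, HasSeries f F := by
  obtain ⟨n, hn⟩ := hF
  have h : ∀ (A : Fin q → Fin 4) (B : Fin p → Fin 4), ∃ Q,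
      taylor Q = fun m => F A (Sum.elim m (indexCount B)) := fun A B =>
    exists_taylor_eq ((Set.finite_Iic fun _ => (-n).toNat).subset
      fun m hm i => le_of_weightGE (hn A) hm i)
  choose Q hQ using h
  exact ⟨fun x A B => evalY (Q A B) x, fun A B => ⟨Q A B, rfl, hQ A B⟩⟩

theorem inter_derivZ_mem_homZ {F : (Fin (q + 1) → Fin 4) → Ser} (hF : ∀ A, F A ∈ homZ (p + 1))
    (A : Fin q → Fin 4) : inter derivZ F A ∈ homZ p :=
  sum_mem fun C _ m hm => hF _ _ (by rw [degZ_add_single_inr]; omega)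

theorem HasSeries.inter_derivZ_eq_zero {f : Pt → Tens (q + 1) (p + 1)}
    {F : (Fin (q + 1) → Fin 4) → Ser} (hF : HasSeries f F) (hp : ∀ A, F A ∈ homZ (p + 1))
    (h : ∀ x A B, _root_.contr (f x) A B = 0) : inter derivZ F = 0 := by
  have hc := hF.contr
  rw [show (fun x => _root_.contr (f x)) = (fun _ _ _ => 0 : Pt → Tens q p) from
    by funext x A B; exact h x A B] at hc
  exact hc.right_unique hasSeries_zero (inter_derivZ_mem_homZ hp) fun _ => (homZ p).zero_mem

theorem HasSeries.wedge_opP_eq_zero {f : Pt → Tens q (p + 1)} {F : (Fin q → Fin 4) → Ser}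
    (hF : HasSeries f F) (ha : IsAlt F) (hp : ∀ A, F A ∈ homZ (p + 1))
    (h : ∀ x A B, Dop f x A B = 0) : wedge opP F = 0 := by
  have hd := hF.dop ha
  rw [show (fun x => Dop f x) = (fun _ _ _ => 0 : Pt → Tens (q + 1) p) from
    by funext x A B; exact h x A B] at hd
  have h0 := hd.right_unique hasSeries_zero
    (fun A => Submodule.smul_mem _ _ (wedge_opP_mem_homZ hp A)) fun _ => (homZ p).zero_mem
  exact (smul_eq_zero.mp h0).resolve_left (inv_ne_zero (Nat.cast_add_one_ne_zero q))

/-- A preimage of the generating series under `wedge opP` gives a preimage under `Dop`. -/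
theorem exists_dop_eq {f : Pt → Tens (q + 1) p} {F : (Fin (q + 1) → Fin 4) → Ser}
    (hF : HasSeries f F) {U : (Fin q → Fin 4) → Ser} (Ua : IsAlt U)
    (Ub : IsBdd (weightGE wtY) U) (hU : wedge opP U = F) :
    ∃ u : Pt → Tens q (p + 1), HasSeries u (((q : ℂ) + 1) • U) ∧ IsPolyMap u ∧
      (∀ x, IsMixed (u x)) ∧ ∀ x A B, Dop u x A B = f x A B := by
  have ha : IsAlt (((q : ℂ) + 1) • U) := Ua.map (((q : ℂ) + 1) • LinearMap.id)
  obtain ⟨u, hu⟩ := exists_hasSeries_of_isBdd (p + 1)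
    (Ub.imp fun n hn A => Submodule.smul_mem _ ((q : ℂ) + 1) (hn A) :
      IsBdd (weightGE wtY) (((q : ℂ) + 1) • U))
  refine ⟨u, hu, hu.isPolyMap, fun x => ⟨hu.antiSup ha x, hu.symSub x⟩, ?_⟩
  have hw : wedge opP (((q : ℂ) + 1) • U) = ((q : ℂ) + 1) • wedge opP U := by
    funext A
    simp only [wedge, Pi.smul_apply, map_smul, Finset.smul_sum]
    exact Finset.sum_congr rfl fun i _ => smul_comm _ _ _
  have hd := hu.dop ha
  rw [hw, smul_smul, inv_mul_cancel₀ (Nat.cast_add_one_ne_zero q), one_smul, hU] at hd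
  exact hd.left_unique hF

theorem contr_eq_zero {u : Pt → Tens (q + 1) (p + 1)} {U : (Fin (q + 1) → Fin 4) → Ser} {a : ℂ}
    (hu : HasSeries u (a • U)) (h0 : inter derivZ U = 0) (x : Pt) (A : Fin q → Fin 4)
    (B : Fin p → Fin 4) : contr (u x) A B = 0 := by
  have h := hu.contr
  have hw : inter derivZ (a • U) = 0 := by
    rw [show inter derivZ (a • U) = a • inter derivZ U by
      funext A
      simp [inter, Finset.smul_sum], h0, smul_zero]
  rw [hw] at h
  exact h.left_unique hasSeries_zero x A B

end Representation

/-- For `k = m + 6 ≥ 6`, the sequence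
`P(ℝ⁶,𝒱₀) →𝒟₀ P(ℝ⁶,𝒱₁) →𝒟₁ P(ℝ⁶,𝒱₂) →𝒟₂ P(ℝ⁶,𝒱₃) → 0`
of spaces of `𝒱_l`-valued polynomials is exact. -/
theorem polynomial_complex_exact (k m : ℕ) (hk : k = m + 6) :
    -- exactness at P(ℝ⁶,𝒱₁)
    (∀ f : Pt → Tens 1 (m+5), IsPolyMap f → (∀ x, InV (f x)) →
      (∀ x A B, Dop f x A B = 0) →
      ∃ u : Pt → Tens 0 (m+6), IsPolyMap u ∧ (∀ x, InV0 (u x)) ∧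
        ∀ x A B, Dop u x A B = f x A B) ∧
    -- exactness at P(ℝ⁶,𝒱₂)
    (∀ f : Pt → Tens 2 (m+4), IsPolyMap f → (∀ x, InV (f x)) →
      (∀ x A B, Dop f x A B = 0) →
      ∃ u : Pt → Tens 1 (m+5), IsPolyMap u ∧ (∀ x, InV (u x)) ∧
        ∀ x A B, Dop u x A B = f x A B) ∧
    -- surjectivity onto P(ℝ⁶,𝒱₃)
    (∀ f : Pt → Tens 3 (m+3), IsPolyMap f → (∀ x, InV (f x)) →
      ∃ u : Pt → Tens 2 (m+4), IsPolyMap u ∧ (∀ x, InV (u x)) ∧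
        ∀ x A B, Dop u x A B = f x A B) := by
  refine ⟨fun f hf hV hD => ?_, fun f hf hV hD => ?_, fun f hf hV => ?_⟩
  · obtain ⟨F, hF, ha, hb, hp⟩ := exists_hasSeries hf (fun x => (hV x).1.2) fun x => (hV x).1.1
    obtain ⟨U, Ua, Ub, hU⟩ := series_exact_one ha hb hp
      (hF.inter_derivZ_eq_zero hp fun x => (hV x).2) (hF.wedge_opP_eq_zero ha hp hD)
    obtain ⟨u, -, up, um, hu⟩ := exists_dop_eq hF Ua Ub hU
    exact ⟨u, up, um, hu⟩
  · obtain ⟨F, hF, ha, hb, hp⟩ := exists_hasSeries hf (fun x => (hV x).1.2) fun x => (hV x).1.1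
    obtain ⟨U, Ua, Ub, U0, hU⟩ := series_exact_two (by omega) ha hb hp
      (hF.inter_derivZ_eq_zero hp fun x => (hV x).2) (hF.wedge_opP_eq_zero ha hp hD)
    obtain ⟨u, us, up, um, hu⟩ := exists_dop_eq hF Ua Ub hU
    exact ⟨u, up, fun x => ⟨um x, contr_eq_zero us U0 x⟩, hu⟩
  · obtain ⟨F, hF, ha, hb, hp⟩ := exists_hasSeries hf (fun x => (hV x).1.2) fun x => (hV x).1.1
    obtain ⟨U, Ua, Ub, U0, hU⟩ := series_exact_three ha hb hp
      (hF.inter_derivZ_eq_zero hp fun x => (hV x).2)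
    obtain ⟨u, us, up, um, hu⟩ := exists_dop_eq hF Ua Ub hU
    exact ⟨u, up, fun x => ⟨um x, contr_eq_zero us U0 x⟩, hu⟩
end
end

section
/- Let k ≥ 4 and l ∈ {0,1,2}. If f ∈ C^∞(ℝ⁶, V_l) satisfies 𝒞(f(x)) = 0 for all x (i.e. f is 𝒱_l-valued), then 𝒞(𝒟_l f)(x) = 0 for all x, i.e. 𝒟_l f is 𝒱_{l+1}-valued. -/
open scoped BigOperators ComplexConjugate ENNReal
open MeasureTheory

set_option maxHeartbeats 1000000

noncomputable section

lemma nablaCoeff_antisymm (A B : Fin 4) (j : Fin 6) :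
    nablaCoeff A B j = -nablaCoeff B A j := by
  fin_cases A <;> fin_cases B <;> simp [nablaCoeff, -Matrix.neg_cons]

lemma nabla_antisymm (A B : Fin 4) (u : Pt → ℂ) (x : Pt) :
    nabla A B u x = -nabla B A u x := by
  simp only [nabla, ← Finset.sum_neg_distrib]
  refine Finset.sum_congr rfl fun j _ => ?_
  rw [nablaCoeff_antisymm A B j, neg_mul]

lemma nabla_zero (A B : Fin 4) (x : Pt) : nabla A B (fun _ => 0) x = 0 := by
  simp [nabla, pd]

lemma nabla_sum {ι : Type*} (s : Finset ι) (A B : Fin 4) (u : ι → Pt → ℂ) (x : Pt)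
    (hu : ∀ i ∈ s, DifferentiableAt ℝ (u i) x) :
    nabla A B (fun y => ∑ i ∈ s, u i y) x = ∑ i ∈ s, nabla A B (u i) x := by
  simp only [nabla, pd, fderiv_fun_sum hu, sum_apply, Finset.mul_sum]
  exact Finset.sum_comm

/-- The contraction of `∇` with a family symmetric in its two indices vanishes. -/
lemma sum_nabla_eq_zero_of_symm (g : Idx → Idx → Pt → ℂ) (hg : ∀ C D, g C D = g D C) (x : Pt) :
    ∑ C : Idx, ∑ D : Idx, nabla D C (g D C) x = 0 := by
  have h : ∑ C : Idx, ∑ D : Idx, nabla D C (g D C) x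
      = -∑ C : Idx, ∑ D : Idx, nabla D C (g D C) x := by
    conv_lhs => rw [Finset.sum_comm]
    simp only [← Finset.sum_neg_distrib]
    refine Finset.sum_congr rfl fun C _ => Finset.sum_congr rfl fun D _ => ?_
    rw [nabla_antisymm C D, hg C D]
  exact self_eq_neg.mp h

/-- Exchanging the first and the last subscript of a tensor symmetric in its subscripts. -/
lemma SymSub.cons_snoc_comm {q p : ℕ} {f : Tens q (p + 2)} (hf : SymSub f)
    (A : Fin q → Idx) (B : Fin p → Idx) (C D : Idx) :
    f A (Fin.cons C (Fin.snoc B D : Fin (p + 1) → Idx))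
      = f A (Fin.cons D (Fin.snoc B C : Fin (p + 1) → Idx)) := by
  rw [← hf A (Equiv.swap 0 (Fin.last (p + 1)))]
  congr 1
  funext i
  rw [Function.comp_apply]
  induction i using Fin.cases with
  | zero => simp [← Fin.succ_last]
  | succ i =>
    induction i using Fin.lastCases with
    | last => simp [← Fin.succ_last]
    | cast i =>
      rw [Equiv.swap_apply_of_ne_of_ne (Fin.succ_ne_zero _)
        (by simp [← Fin.succ_last, Fin.ext_iff, i.isLt.ne])]
      simp

/-- For a tensor antisymmetric in its superscripts, a vanishing contraction on the first
superscript gives a vanishing contraction on every superscript. -/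
lemma AntiSup.sum_update_eq_zero {q p : ℕ} {f : Tens (q + 1) (p + 1)} (hf : AntiSup f)
    (hc : ∀ A B, contr f A B = 0) (D : Fin (q + 1) → Idx) (j : Fin (q + 1))
    (B : Fin p → Idx) :
    ∑ C : Idx, f (Function.update D j C) (Fin.snoc B C) = 0 := by
  have key : ∀ C : Idx, Function.update D j C
      = (Fin.cons C (Fin.tail (D ∘ Equiv.swap 0 j)) : Fin (q + 1) → Idx) ∘ Equiv.swap 0 j := by
    intro C
    have : Function.update D j C ∘ Equiv.swap 0 j
        = Fin.cons C (Fin.tail (D ∘ Equiv.swap 0 j)) := by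
      funext i
      induction i using Fin.cases with
      | zero => simp
      | succ i =>
        have : Equiv.swap 0 j i.succ ≠ j := by
          rw [Ne, Equiv.swap_apply_eq_iff, Equiv.swap_apply_right]
          exact Fin.succ_ne_zero i
        simp [Function.update_of_ne this, Fin.tail]
    rw [← this]
    funext i
    simp
  rw [Finset.sum_congr rfl fun C _ => by rw [key C, hf], ← Finset.mul_sum]
  exact mul_eq_zero_of_right _ (hc _ B)

lemma contr_Dop_eq_zero {q p : ℕ} (f : Pt → Tens q (p + 2)) (hs : TensSmooth f)
    (hsym : ∀ x, SymSub (f x))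
    (hc : ∀ x (D : Fin q → Idx) (j : Fin q) (B : Fin (p + 1) → Idx),
      ∑ C : Idx, f x (Function.update D j C) (Fin.snoc B C) = 0)
    (x : Pt) (A : Fin q → Idx) (B : Fin p → Idx) : contr (Dop f x) A B = 0 := by
  simp only [contr, Dop, antisymmetrize]
  rw [← Finset.mul_sum, Finset.sum_comm]
  refine mul_eq_zero_of_right _ (Finset.sum_eq_zero fun σ _ => ?_)
  rw [← Finset.mul_sum]
  refine mul_eq_zero_of_right _ ?_
  by_cases h0 : σ 0 = 0
  · have htail : ∀ C : Idx, Fin.tail ((Fin.cons C A : Fin (q + 1) → Idx) ∘ σ)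
        = Fin.tail ((Fin.cons 0 A : Fin (q + 1) → Idx) ∘ σ) := by
      intro C
      funext i
      have hi : σ i.succ ≠ 0 := fun h => Fin.succ_ne_zero i (σ.injective (h.trans h0.symm))
      obtain ⟨k, hk⟩ := Fin.exists_succ_eq.mpr hi
      simp [Fin.tail, ← hk]
    simp only [htail, Function.comp_apply, h0, Fin.cons_zero]
    exact sum_nabla_eq_zero_of_symm
      (fun D C y => f y (Fin.tail ((Fin.cons 0 A : Fin (q + 1) → Idx) ∘ σ))
        (Fin.cons D (Fin.snoc B C : Fin (p + 1) → Idx)))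
      (fun C D => funext fun y => (hsym y).cons_snoc_comm _ B C D) x
  · obtain ⟨a, ha⟩ := Fin.exists_succ_eq.mpr h0
    have hinv : σ.symm 0 ≠ 0 := fun h => h0 (by rw [← h, Equiv.apply_symm_apply, h])
    obtain ⟨j, hj⟩ := Fin.exists_succ_eq.mpr hinv
    obtain ⟨E, htail⟩ : ∃ E : Fin q → Idx, ∀ C : Idx,
        Fin.tail ((Fin.cons C A : Fin (q + 1) → Idx) ∘ σ) = Function.update E j C := by
      refine ⟨Fin.tail ((Fin.cons 0 A : Fin (q + 1) → Idx) ∘ σ), fun C => ?_⟩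
      funext i
      rcases eq_or_ne i j with rfl | hij
      · simp [Fin.tail, hj]
      · have hi : σ i.succ ≠ 0 := fun h =>
          hij (Fin.succ_injective _ (hj.trans ((Equiv.symm_apply_eq σ).mpr h.symm)).symm)
        obtain ⟨k, hk⟩ := Fin.exists_succ_eq.mpr hi
        simp [Fin.tail, ← hk, hij]
    simp only [htail, Function.comp_apply, ← ha, Fin.cons_succ]
    rw [Finset.sum_comm]
    refine Finset.sum_eq_zero fun D _ => ?_
    rw [← nabla_sum _ _ _ _ _ fun C _ =>
      ((hs _ _).differentiable (by simp)).differentiableAt]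
    simp only [Fin.cons_snoc_eq_snoc_cons, hc, nabla_zero]

/-- For `k = m + 4 ≥ 4` and `l = 0,1,2`: if `f ∈ C^∞(ℝ⁶,V_l)` is
`𝒱_l`-valued (its contraction vanishes; vacuous for `l = 0`), then `𝒟_l f` is
`𝒱_{l+1}`-valued, i.e. `𝒞(𝒟_l f)(x) = 0` for all `x`. -/
theorem Dop_preserves_contraction_free (k m : ℕ) (hk : k = m + 4) :
    (∀ f : Pt → Tens 0 (m+4), TensSmooth f → (∀ x, IsMixed (f x)) →
      ∀ x A B, contr (Dop f x) A B = 0) ∧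
    (∀ f : Pt → Tens 1 (m+3), TensSmooth f → (∀ x, IsMixed (f x)) →
      (∀ x A B, contr (f x) A B = 0) →
      ∀ x A B, contr (Dop f x) A B = 0) ∧
    (∀ f : Pt → Tens 2 (m+2), TensSmooth f → (∀ x, IsMixed (f x)) →
      (∀ x A B, contr (f x) A B = 0) →
      ∀ x A B, contr (Dop f x) A B = 0) := by
  refine ⟨fun f hs hf x A B => ?_, fun f hs hf hc x A B => ?_, fun f hs hf hc x A B => ?_⟩
  · exact contr_Dop_eq_zero f hs (fun y => (hf y).2) (fun _ _ j => j.elim0) x A B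
  · exact contr_Dop_eq_zero f hs (fun y => (hf y).2)
      (fun y => (hf y).1.sum_update_eq_zero (hc y)) x A B
  · exact contr_Dop_eq_zero f hs (fun y => (hf y).2)
      (fun y => (hf y).1.sum_update_eq_zero (hc y)) x A B
end
end
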